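/- arXiv:math/0409521 — 9 statements merged into one kernel-verified Lean document; each statement's English description precedes it below -/
import Mathlib

section
/- Let A = {a_s (mod n_s)}_{s=1}^k and B = {b_t (mod m_t)}_{t=1}^l be two finite systems of residue classes with 0 ≤ a_s < n_s for each s and 0 ≤ b_t < m_t for each t. Let p be a prime greater than |S(n_1,...,n_k,m_1,...,m_l)|, and let ζ_p be a primitive p-th root of unity. Then A and B are covering equivalent if and only if Σ_{s=1}^k ζ_p^{a_s}/(1 − ζ_p^{n_s}) = Σ_{t=1}^l ζ_p^{b_t}/(1 − ζ_p^{m_t}). -/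
open Finset
open scoped Classical

/-- The power series `∑ X ^ x` over the `x ≡ a (mod n)` is `X ^ a / (1 - X ^ n)`. -/
lemma one_sub_X_pow_mul_mk_residue {a n : ℕ} (ha : a < n) :
    (1 - (PowerSeries.X : PowerSeries ℚ) ^ n) *
      PowerSeries.mk (fun x : ℕ => if (n : ℤ) ∣ (x : ℤ) - a then (1 : ℚ) else 0) =
      PowerSeries.X ^ a := by
  ext x
  rw [sub_mul, one_mul, map_sub, PowerSeries.coeff_X_pow_mul', PowerSeries.coeff_X_pow,
    PowerSeries.coeff_mk]
  rw [PowerSeries.coeff_mk]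
  by_cases hx : n ≤ x
  · have hxa : x ≠ a := by omega
    rw [if_pos hx, if_neg hxa, Nat.cast_sub hx, sub_right_comm]
    simp only [dvd_sub_self_right, sub_self]
  · have hxa : (n : ℤ) ∣ x - a ↔ x = a := by
      refine ⟨fun h => ?_, fun h => by simp [h]⟩
      have := Int.eq_zero_of_abs_lt_dvd h (by rw [abs_lt]; omega)
      omega
    simp only [if_neg hx, hxa, sub_zero]

/-- The product of the cyclotomic polynomials whose index divides some `n i`; up to sign this is
the product of the `X - e ^ (2πir)` over the fractions `r ∈ [0, 1)` with some denominator `n i`. -/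
noncomputable def cyclotomicLcm {ι : Type*} [Fintype ι] (n : ι → ℕ) : Polynomial ℚ :=
  ∏ d ∈ univ.biUnion fun i => (n i).divisors, Polynomial.cyclotomic d ℚ

lemma cyclotomicLcm_ne_zero {ι : Type*} [Fintype ι] (n : ι → ℕ) : cyclotomicLcm n ≠ 0 :=
  prod_ne_zero_iff.2 fun d _ => Polynomial.cyclotomic_ne_zero d ℚ

lemma X_pow_sub_one_dvd_cyclotomicLcm {ι : Type*} [Fintype ι] (n : ι → ℕ) {i : ι}
    (hn : 0 < n i) : (Polynomial.X ^ n i - 1 : Polynomial ℚ) ∣ cyclotomicLcm n := by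
  rw [← Polynomial.prod_cyclotomic_eq_X_pow_sub_one hn]
  exact prod_dvd_prod_of_subset _ _ _ (subset_biUnion_of_mem (fun i => (n i).divisors) (mem_univ i))

lemma natDegree_cyclotomicLcm_le {ι : Type*} [Fintype ι] (n : ι → ℕ) :
    (cyclotomicLcm n).natDegree ≤
      ((univ : Finset ι).biUnion fun i =>
        (range (n i)).image fun r : ℕ => (r : ℚ) / (n i : ℚ)).card := by
  rw [cyclotomicLcm, Polynomial.natDegree_prod _ _ fun d _ => Polynomial.cyclotomic_ne_zero d ℚ]
  simp only [Polynomial.natDegree_cyclotomic, Nat.totient]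
  rw [← card_sigma]
  refine card_le_card_of_injOn (fun q => (q.2 : ℚ) / (q.1 : ℚ)) ?_ ?_
  · rintro ⟨d, r⟩ h
    simp only [coe_sigma, Set.mem_sigma_iff, mem_coe, mem_biUnion, mem_univ, true_and,
      Nat.mem_divisors, mem_filter, mem_range] at h
    obtain ⟨⟨i, ⟨e, he⟩, hi⟩, hr, -⟩ := h
    simp only [mem_coe, mem_biUnion, mem_univ, true_and, mem_image, mem_range]
    have he0 : 0 < e := Nat.pos_of_ne_zero (by rintro rfl; simp [he] at hi)
    have hd0 : (d : ℚ) ≠ 0 := by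
      rintro h; simp only [Nat.cast_eq_zero] at h; simp [he, h] at hi
    refine ⟨i, r * e, ?_, ?_⟩
    · rw [he]; exact Nat.mul_lt_mul_of_pos_right hr he0
    · rw [he]; push_cast
      exact mul_div_mul_right _ _ (by positivity)
  · rintro ⟨d, r⟩ h ⟨d', r'⟩ h' heq
    simp only [coe_sigma, Set.mem_sigma_iff, mem_coe, mem_filter, mem_range] at h h' heq
    have hd : d = d' := by
      have h1 := Rat.den_div_eq_of_coprime (a := r) (b := d) (by omega) h.2.2.symm
      have h2 := Rat.den_div_eq_of_coprime (a := r') (b := d') (by omega) h'.2.2.symm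
      push_cast at h1 h2
      rw [heq] at h1
      exact_mod_cast h1.symm.trans h2
    subst hd
    have hd0 : (d : ℚ) ≠ 0 := by
      have : 0 < d := by omega
      positivity
    rw [div_left_inj' hd0] at heq
    simpa using heq

/-- A rational combination of indicators of residue classes vanishes iff the corresponding
combination of generating functions vanishes at `ζ`. -/
lemma sum_residue_eq_zero_iff {ι : Type*} [Fintype ι] (a n : ι → ℕ) (c : ι → ℚ)
    (ha : ∀ i, a i < n i) {p : ℕ} (hp : p.Prime)
    (hpS : ((univ : Finset ι).biUnion fun i =>
        (range (n i)).image fun r : ℕ => (r : ℚ) / (n i : ℚ)).card < p)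
    {ζ : ℂ} (hζ : IsPrimitiveRoot ζ p) :
    (∀ x : ℕ, ∑ i, c i * (if (n i : ℤ) ∣ (x : ℤ) - a i then 1 else 0) = 0) ↔
      ∑ i, (c i : ℂ) * (ζ ^ a i / (1 - ζ ^ n i)) = 0 := by
  have hn : ∀ i, 0 < n i := fun i => (Nat.zero_le _).trans_lt (ha i)
  have hnp : ∀ i, n i < p := fun i => by
    refine lt_of_le_of_lt ?_ hpS
    refine le_trans (le_of_eq ?_) (card_le_card (subset_biUnion_of_mem (fun i =>
        (range (n i)).image fun r : ℕ => (r : ℚ) / (n i : ℚ)) (mem_univ i)))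
    rw [card_image_of_injective, card_range]
    intro r r' h
    have : (n i : ℚ) ≠ 0 := by exact_mod_cast (hn i).ne'
    simpa [div_left_inj' this] using h
  choose C hC using fun i => X_pow_sub_one_dvd_cyclotomicLcm n (hn i)
  set P := cyclotomicLcm n with hP
  have hP0 : P ≠ 0 := cyclotomicLcm_ne_zero n
  have hPζ : Polynomial.aeval ζ P ≠ 0 := by
    rw [hP, cyclotomicLcm, map_prod]
    refine prod_ne_zero_iff.2 fun d hd h0 => ?_
    simp only [mem_biUnion, mem_univ, true_and, Nat.mem_divisors] at hd
    obtain ⟨i, hdi, -⟩ := hd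
    have hd0 : 0 < d := Nat.pos_of_dvd_of_pos hdi (hn i)
    have : NeZero (d : ℂ) := ⟨by exact_mod_cast hd0.ne'⟩
    rw [Polynomial.aeval_def, Polynomial.eval₂_eq_eval_map, Polynomial.map_cyclotomic,
      ← Polynomial.IsRoot.def, Polynomial.isRoot_cyclotomic_iff] at h0
    have : d = p := h0.unique hζ
    exact absurd (Nat.le_of_dvd (hn i) hdi) (by have := hnp i; omega)
  set Q : Polynomial ℚ := ∑ i, Polynomial.C (c i) * (Polynomial.X ^ a i * C i) with hQ
  have hdeg : Q.degree < P.degree := by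
    rw [Polynomial.degree_eq_natDegree hP0, ← Polynomial.mem_degreeLT]
    refine Submodule.sum_mem _ fun i _ => ?_
    rw [← Polynomial.smul_eq_C_mul]
    refine Submodule.smul_mem _ _ ?_
    have hC0 : C i ≠ 0 := by
      intro h; apply hP0; rw [hC i, h, mul_zero]
    rw [Polynomial.mem_degreeLT, ← Polynomial.degree_eq_natDegree hP0, hC i,
      Polynomial.degree_mul, Polynomial.degree_mul, Polynomial.degree_X_pow,
      ← Polynomial.C_1, Polynomial.degree_X_pow_sub_C (hn i),
      Polynomial.degree_eq_natDegree hC0]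
    have := ha i
    exact_mod_cast Nat.add_lt_add_right this _
  have hQζ : Polynomial.aeval ζ Q = 0 ↔ Q = 0 := by
    refine ⟨fun h => ?_, fun h => by rw [h, map_zero]⟩
    refine Polynomial.eq_zero_of_dvd_of_degree_lt (minpoly.dvd ℚ ζ h) (hdeg.trans_le ?_)
    rw [← Polynomial.cyclotomic_eq_minpoly_rat hζ hp.pos, Polynomial.degree_cyclotomic,
      Nat.totient_prime hp, Polynomial.degree_eq_natDegree hP0]
    have := (natDegree_cyclotomicLcm_le n).trans_lt hpS
    exact_mod_cast (by rw [hP]; omega : P.natDegree ≤ p - 1)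
  have hsum : Polynomial.aeval ζ P * ∑ i, (c i : ℂ) * (ζ ^ a i / (1 - ζ ^ n i)) =
      -Polynomial.aeval ζ Q := by
    rw [hQ, map_sum, mul_sum, ← sum_neg_distrib]
    refine sum_congr rfl fun i _ => ?_
    have h1 : 1 - ζ ^ n i ≠ 0 := by
      rw [sub_ne_zero]
      exact (hζ.pow_ne_one_of_pos_of_lt (hn i).ne' (hnp i)).symm
    rw [hC i]
    simp only [map_mul, map_sub, map_pow, Polynomial.aeval_X, map_one, Polynomial.aeval_C,
      eq_ratCast]
    field_simp
    ring
  have hser : (P : PowerSeries ℚ) * PowerSeries.mk (fun x : ℕ =>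
      ∑ i, c i * (if (n i : ℤ) ∣ (x : ℤ) - a i then (1 : ℚ) else 0)) =
      -(Q : PowerSeries ℚ) := by
    have hmk : PowerSeries.mk (fun x : ℕ =>
        ∑ i, c i * (if (n i : ℤ) ∣ (x : ℤ) - a i then (1 : ℚ) else 0)) =
        ∑ i, PowerSeries.C (c i) * PowerSeries.mk (fun x : ℕ =>
          if (n i : ℤ) ∣ (x : ℤ) - a i then (1 : ℚ) else 0) := by
      ext x
      simp only [PowerSeries.coeff_mk, map_sum, PowerSeries.coeff_C_mul]
    have hQs : (Q : PowerSeries ℚ) =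
        ∑ i, PowerSeries.C (c i) * (PowerSeries.X ^ a i * (C i : PowerSeries ℚ)) := by
      rw [hQ, ← Polynomial.coeToPowerSeries.ringHom_apply, map_sum]
      simp
    rw [hmk, hQs, mul_sum, ← sum_neg_distrib]
    refine sum_congr rfl fun i _ => ?_
    rw [← one_sub_X_pow_mul_mk_residue (ha i), hC i]
    push_cast
    ring
  have hPs : (P : PowerSeries ℚ) ≠ 0 := by
    simpa using hP0
  calc _ ↔ PowerSeries.mk (fun x : ℕ =>
        ∑ i, c i * (if (n i : ℤ) ∣ (x : ℤ) - a i then (1 : ℚ) else 0)) = 0 := by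
        simp only [PowerSeries.ext_iff, PowerSeries.coeff_mk, map_zero]
    _ ↔ Q = 0 := by
        rw [← mul_eq_zero_iff_left hPs, hser, neg_eq_zero, Polynomial.coe_eq_zero_iff]
    _ ↔ _ := by
        rw [← hQζ, ← neg_eq_zero, ← hsum, mul_eq_zero_iff_left hPζ]

/-- **Theorem 1.1** (Pan–Sun). Let `A = {a_s (mod n_s)}_{s=1}^k` and
`B = {b_t (mod m_t)}_{t=1}^l` be systems of residue classes with `0 ≤ a_s < n_s`
and `0 ≤ b_t < m_t`.  Let `p` be a prime greater than
`|S(n_1,…,n_k,m_1,…,m_l)|`, where `S(…) = {r/n : r = 0,…,n−1, n a modulus}`,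
and let `ζ` be a primitive `p`-th root of unity.  Then `A` and `B` are covering
equivalent iff `∑_s ζ^{a_s}/(1−ζ^{n_s}) = ∑_t ζ^{b_t}/(1−ζ^{m_t})`. -/
theorem covering_equivalent_iff
    {k l : ℕ} (a n : Fin k → ℕ) (b m : Fin l → ℕ)
    (hn : ∀ s, 0 < n s) (ha : ∀ s, a s < n s)
    (hm : ∀ t, 0 < m t) (hb : ∀ t, b t < m t)
    (p : ℕ) (hp : p.Prime)
    (hpS : (((univ : Finset (Fin k)).biUnion fun s =>
               (range (n s)).image fun r => (r : ℚ) / (n s : ℚ)) ∪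
            ((univ : Finset (Fin l)).biUnion fun t =>
               (range (m t)).image fun r => (r : ℚ) / (m t : ℚ))).card < p)
    (ζ : ℂ) (hζ : IsPrimitiveRoot ζ p) :
    (∀ x : ℤ, ((univ : Finset (Fin k)).filter fun s => (n s : ℤ) ∣ x - (a s : ℤ)).card =
              ((univ : Finset (Fin l)).filter fun t => (m t : ℤ) ∣ x - (b t : ℤ)).card) ↔
    ∑ s, ζ ^ (a s) / (1 - ζ ^ (n s)) = ∑ t, ζ ^ (b t) / (1 - ζ ^ (m t)) := by
  have hS : ((univ : Finset (Fin k ⊕ Fin l)).biUnion fun i =>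
      (range (Sum.elim n m i)).image fun r : ℕ => (r : ℚ) / ((Sum.elim n m i : ℕ) : ℚ)).card < p := by
    convert hpS using 2
    ext q
    simp
  have key := sum_residue_eq_zero_iff (Sum.elim a b) (Sum.elim n m)
    (Sum.elim (fun _ => 1) (fun _ => -1)) (by rintro (i | i) <;> simp [ha, hb]) hp hS hζ
  simp only [Fintype.sum_sum_type] at key
  change (∀ x : ℕ, ∑ s, (1 : ℚ) * (if (n s : ℤ) ∣ (x : ℤ) - a s then 1 else 0) +
    ∑ t, (-1 : ℚ) * (if (m t : ℤ) ∣ (x : ℤ) - b t then 1 else 0) = 0) ↔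
    ∑ s, ((1 : ℚ) : ℂ) * (ζ ^ a s / (1 - ζ ^ n s)) +
      ∑ t, ((-1 : ℚ) : ℂ) * (ζ ^ b t / (1 - ζ ^ m t)) = 0 at key
  simp only [one_mul, neg_mul, sum_neg_distrib, Rat.cast_one, Rat.cast_neg, ← sub_eq_add_neg,
    sub_eq_zero, sum_boole, Nat.cast_inj] at key
  rw [← key]
  refine ⟨fun h x => h x, fun h x => ?_⟩
  -- Shift `x` by a common multiple of all the moduli to make it nonnegative.
  set N : ℕ := (∏ s, n s) * ∏ t, m t with hN
  have hN0 : 0 < N := Nat.mul_pos (prod_pos fun s _ => hn s) (prod_pos fun t _ => hm t)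
  have hnN : ∀ s, (n s : ℤ) ∣ x.natAbs * N := fun s => by
    exact_mod_cast ((dvd_prod_of_mem n (mem_univ s)).mul_right _).mul_left _
  have hmN : ∀ t, (m t : ℤ) ∣ x.natAbs * N := fun t => by
    exact_mod_cast ((dvd_prod_of_mem m (mem_univ t)).mul_left _).mul_left _
  have hx : 0 ≤ x + x.natAbs * N := by
    have : (x.natAbs : ℤ) * 1 ≤ x.natAbs * N := by gcongr; exact_mod_cast hN0
    omega
  have := h (x + x.natAbs * N).toNat
  rw [Int.toNat_of_nonneg hx] at this
  simpa only [add_sub_right_comm, dvd_add_left (hnN _), dvd_add_left (hmN _)] using this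
end

section
/- Let A = {a_s (mod n_s)}_{s=1}^k be a finite system of residue classes with 0 ≤ a_s < n_s for each s, let m be a positive integer, and let p be any prime greater than |S(n_1,...,n_k)|. Then A forms an exact m-cover of ℤ if and only if Σ_{s=1}^k e^{2πi a_s/p}/(1 − e^{2πi n_s/p}) = m/(1 − e^{2πi/p}). -/
open Finset Complex
open scoped Classical Real

section CoveringPolynomial

open Polynomial

theorem sum_X_pow_residue_class_mul {R : Type*} [CommRing R] {a n N : ℕ} (ha : a < n)
    (hN : n ∣ N) :
    (∑ x ∈ (range N).filter (fun x : ℕ => (n : ℤ) ∣ (x : ℤ) - a), (X : R[X]) ^ x) *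
      (X ^ n - 1) = X ^ a * (X ^ N - 1) := by
  obtain ⟨t, rfl⟩ := hN
  have hclass : (range (n * t)).filter (fun x : ℕ => (n : ℤ) ∣ (x : ℤ) - a) =
      (range t).image (fun j => a + n * j) := by
    ext x
    simp only [mem_filter, Finset.mem_range, Finset.mem_image]
    constructor
    · rintro ⟨hx, hdvd⟩
      have hmod : x % n = a := by
        have h : a ≡ x [MOD n] := (Nat.modEq_iff_dvd).2 hdvd
        rw [← Nat.mod_eq_of_lt ha]
        exact h.symm
      refine ⟨x / n, Nat.div_lt_of_lt_mul hx, ?_⟩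
      rw [← hmod]
      exact Nat.mod_add_div x n
    · rintro ⟨j, hj, rfl⟩
      refine ⟨?_, ⟨j, by push_cast; ring⟩⟩
      nlinarith
  rw [hclass, sum_image]
  · simp only [pow_add, pow_mul, ← mul_sum]
    rw [mul_assoc, geom_sum_mul]
  · intro i _ j _ hij
    exact Nat.eq_of_mul_eq_mul_left (by omega) (Nat.add_left_cancel hij)

/-- The least common multiple of the polynomials `X ^ n s - 1`, as a product of cyclotomic
polynomials. -/
noncomputable def coverDenominator {ι : Type*} [Fintype ι] (n : ι → ℕ) : ℚ[X] :=
  ∏ d ∈ (univ : Finset ι).biUnion (fun s => (n s).divisors), cyclotomic d ℚ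

theorem coverDenominator_monic {ι : Type*} [Fintype ι] (n : ι → ℕ) :
    (coverDenominator n).Monic :=
  monic_prod_of_monic _ _ fun d _ => cyclotomic.monic d ℚ

theorem X_pow_sub_one_dvd_coverDenominator {ι : Type*} [Fintype ι] {n : ι → ℕ}
    (s : ι) (hs : 0 < n s) : X ^ n s - 1 ∣ coverDenominator n := by
  rw [← prod_cyclotomic_eq_X_pow_sub_one hs ℚ]
  exact prod_dvd_prod_of_subset _ _ _ (subset_biUnion_of_mem (fun s => (n s).divisors)
    (mem_univ s))

theorem natDegree_coverDenominator_le {ι : Type*} [Fintype ι] (n : ι → ℕ) :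
    (coverDenominator n).natDegree ≤ ((univ : Finset ι).biUnion fun s =>
      (range (n s)).image fun r : ℕ => (r : ℚ) / (n s : ℚ)).card := by
  have hdeg : (coverDenominator n).natDegree =
      (((univ : Finset ι).biUnion fun s => (n s).divisors).biUnion
        fun d => primitiveRoots d ℂ).card := by
    rw [coverDenominator, natDegree_prod_of_monic _ _ fun d _ => cyclotomic.monic d ℚ,
      card_biUnion fun i _ j _ hij => IsPrimitiveRoot.disjoint hij]
    exact sum_congr rfl fun d _ => by
      rw [natDegree_cyclotomic, Complex.card_primitiveRoots]
  rw [hdeg]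
  refine (card_le_card ?_).trans
    (card_image_le (f := fun q : ℚ => Complex.exp (2 * π * I * (q : ℂ))))
  intro z hz
  simp only [mem_biUnion, mem_univ, true_and, Nat.mem_divisors] at hz
  obtain ⟨d, ⟨s, hds, hs⟩, hz⟩ := hz
  have hroot : z ^ n s = 1 :=
    ((isPrimitiveRoot_of_mem_primitiveRoots hz).pow_eq_one_iff_dvd _).2 hds
  have : NeZero (n s) := ⟨hs⟩
  obtain ⟨r, hr, hrz⟩ :=
    (Complex.isPrimitiveRoot_exp (n s) hs).eq_pow_of_pow_eq_one hroot
  refine Finset.mem_image.2 ⟨(r : ℚ) / n s, ?_, ?_⟩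
  · exact mem_biUnion.2 ⟨s, mem_univ s, Finset.mem_image.2 ⟨r, Finset.mem_range.2 hr, rfl⟩⟩
  · rw [← hrz, ← Complex.exp_nat_mul]
    congr 1
    push_cast
    ring

theorem aeval_coverDenominator_ne_zero {ι : Type*} [Fintype ι] {n : ι → ℕ} {p : ℕ} {ζ : ℂ}
    (hζ : IsPrimitiveRoot ζ p) (hnp : ∀ s, n s < p) :
    aeval ζ (coverDenominator n) ≠ 0 := by
  rw [coverDenominator, map_prod, prod_ne_zero_iff]
  intro d hd h
  simp only [mem_biUnion, mem_univ, true_and, Nat.mem_divisors] at hd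
  obtain ⟨s, hds, hs⟩ := hd
  obtain ⟨c, hc⟩ := (cyclotomic.dvd_X_pow_sub_one d ℚ).trans
    (show (X : ℚ[X]) ^ d - 1 ∣ X ^ n s - 1 from by
      obtain ⟨e, he⟩ := hds
      rw [he, pow_mul]
      exact sub_one_dvd_pow_sub_one _ _)
  have hpow : aeval ζ ((X : ℚ[X]) ^ n s - 1) = 0 := by rw [hc, map_mul, h, zero_mul]
  exact hζ.pow_ne_one_of_pos_of_lt hs (hnp s) (by simpa [sub_eq_zero] using hpow)

/-- A system of residue classes is an exact `m`-cover if and only if the identity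
`∑ s, x ^ a s / (1 - x ^ n s) = m / (1 - x)` holds at a primitive `p`-th root of unity, provided
the prime `p` exceeds every modulus and the degree of the common denominator. -/
theorem exact_cover_iff_sum_at_primitiveRoot {ι : Type*} [Fintype ι] [Nonempty ι] {a n : ι → ℕ}
    (hn : ∀ s, 0 < n s) (ha : ∀ s, a s < n s) (m : ℕ) {p : ℕ} (hp : p.Prime)
    (hdeg : (coverDenominator n).natDegree < p) (hnp : ∀ s, n s < p) {ζ : ℂ}
    (hζ : IsPrimitiveRoot ζ p) :
    (∀ x : ℤ, ((univ : Finset ι).filter fun s => (n s : ℤ) ∣ x - (a s : ℤ)).card = m) ↔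
      ∑ s, ζ ^ a s / (1 - ζ ^ n s) = m / (1 - ζ) := by
  set Q := coverDenominator n with hQ
  have hQ0 : Q ≠ 0 := (coverDenominator_monic n).ne_zero
  have hdvd : ∀ s, ∃ c, Q = (X ^ n s - 1) * c := fun s =>
    X_pow_sub_one_dvd_coverDenominator s (hn s)
  choose c hc using hdvd
  obtain ⟨b, hb⟩ : (X - 1 : ℚ[X]) ∣ Q :=
    (sub_one_dvd_pow_sub_one X _).trans
      (X_pow_sub_one_dvd_coverDenominator (Classical.arbitrary ι) (hn _))
  set P : ℚ[X] := ∑ s, X ^ a s * c s - (m : ℚ[X]) * b with hP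
  set N := ∏ s, n s with hN
  have hNpos : 0 < N := prod_pos fun s _ => hn s
  set w : ℤ → ℕ := fun x => ((univ : Finset ι).filter fun s => (n s : ℤ) ∣ x - (a s : ℤ)).card
    with hw
  set F : ℚ[X] := ∑ x ∈ range N, C ((w x : ℚ) - m) * X ^ x with hF
  have hFQ : F * Q = P * (X ^ N - 1) := by
    have hsplit : F = ∑ s, ∑ x ∈ (range N).filter (fun x : ℕ => (n s : ℤ) ∣ (x : ℤ) - a s), X ^ x
        - (m : ℚ[X]) * ∑ x ∈ range N, X ^ x := by
      simp only [hF, hw, sum_filter, card_filter]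
      rw [sum_comm, mul_sum, ← sum_sub_distrib]
      refine sum_congr rfl fun x _ => ?_
      rw [map_sub, sub_mul, map_natCast, map_natCast, Nat.cast_sum, sum_mul]
      simp only [Nat.cast_ite, Nat.cast_one, Nat.cast_zero, ite_mul, one_mul, zero_mul]
    rw [hsplit, hP, sub_mul, sub_mul, sum_mul, sum_mul]
    congr 1
    · refine sum_congr rfl fun s _ => ?_
      rw [hc s, ← mul_assoc, sum_X_pow_residue_class_mul (ha s) (dvd_prod_of_mem n (mem_univ s))]
      ring
    · rw [hb, ← geom_sum_mul]
      ring
  have hcover : (∀ x, w x = m) ↔ F = 0 := by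
    constructor
    · intro h
      simp [hF, h]
    · intro h x
      have hper : w (x % N) = w x := by
        simp only [hw]
        congr 1
        refine filter_congr fun s _ => ?_
        have hdvd : (n s : ℤ) ∣ x - x % N :=
          (Int.natCast_dvd_natCast.2 (dvd_prod_of_mem n (mem_univ s))).trans
            (Int.dvd_self_sub_emod)
        rw [← dvd_add_right hdvd]
        ring_nf
      have hN0 : (N : ℤ) ≠ 0 := by exact_mod_cast hNpos.ne'
      obtain ⟨r, hr⟩ := Int.eq_ofNat_of_zero_le (Int.emod_nonneg x hN0)
      have hrN : r < N := by
        have := Int.emod_lt_of_pos x (show (0 : ℤ) < N by exact_mod_cast hNpos)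
        omega
      have hcoeff := congrArg (coeff · r) h
      simp only [hF, finsetSum_coeff, coeff_C_mul_X_pow, coeff_zero] at hcoeff
      rw [sum_ite_eq, if_pos (Finset.mem_range.2 hrN), sub_eq_zero] at hcoeff
      rw [← hper, hr]
      exact_mod_cast hcoeff
  have hXN : (X ^ N - 1 : ℚ[X]) ≠ 0 := X_pow_sub_C_ne_zero hNpos 1
  have hFP : F = 0 ↔ P = 0 := by
    rw [← mul_eq_zero_iff_right hQ0, hFQ, mul_eq_zero_iff_right hXN]
  have hPdeg : P.degree < Q.degree := by
    refine (degree_sub_le _ _).trans_lt (max_lt ?_ ?_)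
    · refine (degree_sum_le _ _).trans_lt ((Finset.sup_lt_iff ?_).2 fun s _ => ?_)
      · exact bot_lt_iff_ne_bot.2 (degree_ne_bot.2 hQ0)
      · have hcs : c s ≠ 0 := fun h => hQ0 (by rw [hc s, h, mul_zero])
        rw [hc s, degree_mul, degree_mul, degree_X_pow, ← C_1, degree_X_pow_sub_C (hn s),
          degree_eq_natDegree hcs]
        exact_mod_cast Nat.add_lt_add_right (ha s) _
    · have hb0 : b ≠ 0 := fun h => hQ0 (by rw [hb, h, mul_zero])
      have hmb : ((m : ℚ[X]) * b).degree ≤ b.degree := by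
        rw [← C_eq_natCast, ← smul_eq_C_mul]
        exact degree_smul_le _ _
      refine hmb.trans_lt ?_
      rw [hb, degree_mul, ← C_1, degree_X_sub_C, degree_eq_natDegree hb0]
      exact_mod_cast Nat.lt_add_of_pos_left one_pos
  have hPζ : P = 0 ↔ aeval ζ P = 0 := by
    refine ⟨fun h => by rw [h, map_zero], fun h => ?_⟩
    refine eq_zero_of_dvd_of_degree_lt (minpoly.dvd ℚ ζ h) (hPdeg.trans_le ?_)
    rw [← cyclotomic_eq_minpoly_rat hζ hp.pos, degree_cyclotomic, Nat.totient_prime hp,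
      degree_eq_natDegree hQ0]
    exact_mod_cast Nat.le_sub_one_of_lt hdeg
  have hQζ : aeval ζ Q ≠ 0 := aeval_coverDenominator_ne_zero hζ hnp
  have heval : aeval ζ P =
      -aeval ζ Q * (∑ s, ζ ^ a s / (1 - ζ ^ n s) - m / (1 - ζ)) := by
    have hcζ : ∀ s, aeval ζ (c s) = -aeval ζ Q / (1 - ζ ^ n s) := fun s => by
      have h1 : 1 - ζ ^ n s ≠ 0 :=
        sub_ne_zero.2 (hζ.pow_ne_one_of_pos_of_lt (hn s).ne' (hnp s)).symm
      have h2 := congrArg (aeval ζ) (hc s)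
      simp only [map_mul, map_sub, map_pow, aeval_X, map_one] at h2
      rw [eq_div_iff h1, hQ, h2]
      ring
    have hbζ : aeval ζ b = -aeval ζ Q / (1 - ζ) := by
      have h1 : 1 - ζ ≠ 0 := sub_ne_zero.2 (hζ.ne_one hp.one_lt).symm
      have h2 := congrArg (aeval ζ) hb
      simp only [map_mul, map_sub, aeval_X, map_one] at h2
      rw [eq_div_iff h1, h2]
      ring
    rw [hP, mul_sub, mul_sum]
    simp only [map_sub, map_sum, map_mul, map_pow, aeval_X, map_natCast, hcζ, hbζ]
    congr 1
    · exact sum_congr rfl fun s _ => by ring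
    · ring
  rw [hcover, hFP, hPζ, heval, mul_eq_zero, neg_eq_zero, or_iff_right hQζ, sub_eq_zero]

end CoveringPolynomial

/-- **Corollary 1.1** (Pan–Sun). A system `A = {a_s (mod n_s)}_{s=1}^k`
(with `0 ≤ a_s < n_s`) forms an exact `m`-cover of `ℤ` iff
`∑_s e^{2πi a_s/p}/(1 − e^{2πi n_s/p}) = m/(1 − e^{2πi/p})`, where `p` is any
fixed prime greater than `|S(n_1,…,n_k)|`. -/
theorem exact_m_cover_iff
    {k : ℕ} (a n : Fin k → ℕ)
    (hn : ∀ s, 0 < n s) (ha : ∀ s, a s < n s)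
    (m : ℕ) (hm : 0 < m)
    (p : ℕ) (hp : p.Prime)
    (hpS : (((univ : Finset (Fin k)).biUnion fun s =>
               (range (n s)).image fun r => (r : ℚ) / (n s : ℚ))).card < p) :
    (∀ x : ℤ, ((univ : Finset (Fin k)).filter fun s => (n s : ℤ) ∣ x - (a s : ℤ)).card = m) ↔
    ∑ s, Complex.exp (2 * π * I * (a s : ℂ) / (p : ℂ)) /
           (1 - Complex.exp (2 * π * I * (n s : ℂ) / (p : ℂ))) =
      (m : ℂ) / (1 - Complex.exp (2 * π * I / (p : ℂ))) := by
  have hS : ∀ s, ((range (n s)).image fun r => (r : ℚ) / (n s : ℚ)) =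
      (range (n s)).image fun r : ℕ => (r : ℚ) / (n s : ℚ) := fun s => by
    ext q
    simp
  simp only [hS] at hpS
  have hζ := Complex.isPrimitiveRoot_exp p hp.ne_zero
  rcases Nat.eq_zero_or_pos k with rfl | hk
  · have h1 : 1 - Complex.exp (2 * π * I / (p : ℂ)) ≠ 0 :=
      sub_ne_zero.2 (hζ.ne_one hp.one_lt).symm
    have h2 : (m : ℂ) / (1 - Complex.exp (2 * π * I / (p : ℂ))) ≠ 0 :=
      div_ne_zero (by exact_mod_cast hm.ne') h1
    simp [hm.ne, h2.symm]
  have : Nonempty (Fin k) := ⟨⟨0, hk⟩⟩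
  have hnp : ∀ s, n s < p := fun s => by
    refine lt_of_le_of_lt ?_ hpS
    have hinj : Function.Injective fun r : ℕ => (r : ℚ) / (n s : ℚ) := fun r t h => by
      have hs : (n s : ℚ) ≠ 0 := by exact_mod_cast (hn s).ne'
      exact_mod_cast (div_left_inj' hs).1 h
    calc n s = ((range (n s)).image fun r : ℕ => (r : ℚ) / (n s : ℚ)).card := by
          rw [card_image_of_injective _ hinj, card_range]
      _ ≤ _ := card_le_card (subset_biUnion_of_mem
          (fun s => (range (n s)).image fun r : ℕ => (r : ℚ) / (n s : ℚ)) (mem_univ s))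
  have hexp : ∀ j : ℕ, Complex.exp (2 * π * I * (j : ℂ) / (p : ℂ)) =
      Complex.exp (2 * π * I / (p : ℂ)) ^ j := fun j => by
    rw [← Complex.exp_nat_mul]
    congr 1
    ring
  simp only [hexp]
  exact exact_cover_iff_sum_at_primitiveRoot hn ha m hp
    ((natDegree_coverDenominator_le n).trans_lt hpS) hnp hζ
end

section
/- Let k ≥ 1 and let A = {a_s (mod n_s)}_{s=1}^k be a finite system of residue classes with 0 ≤ a_s < n_s for each s. Suppose that Σ_{s=1}^k e^{2πi a_s/p}/(1 − e^{2πi n_s/p}) = 0 where p is a prime. Then n_1 + ... + n_k − k + 1 ≥ |S(n_1,...,n_k)| ≥ p. -/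
open Finset Complex
open scoped Classical Real

open Polynomial in
/-- A vanishing sum of fractions `ζ ^ a s / (1 - ζ ^ n s)` at one primitive root of unity vanishes
at all its conjugates. -/
theorem sum_pow_div_one_sub_pow_eq_zero_of_isPrimitiveRoot {ι : Type*} [Fintype ι] (a n : ι → ℕ)
    {p : ℕ} (hp : 0 < p) (hpn : ∀ s, ¬ p ∣ n s) {ζ μ : ℂ} (hζ : IsPrimitiveRoot ζ p)
    (hμ : IsPrimitiveRoot μ p) (h : ∑ s, ζ ^ a s / (1 - ζ ^ n s) = 0) :
    ∑ s, μ ^ a s / (1 - μ ^ n s) = 0 := by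
  have hne : ∀ {ν : ℂ}, IsPrimitiveRoot ν p → ∀ s, 1 - ν ^ n s ≠ 0 := fun hν s h0 =>
    hpn s ((hν.pow_eq_one_iff_dvd _).1 (sub_eq_zero.1 h0).symm)
  let g : ℤ[X] := ∑ s, X ^ a s * ∏ t ∈ univ.erase s, (1 - X ^ n t)
  have hg : ∀ {ν : ℂ}, IsPrimitiveRoot ν p →
      aeval ν g = (∏ t, (1 - ν ^ n t)) * ∑ s, ν ^ a s / (1 - ν ^ n s) := by
    intro ν hν
    simp only [g, map_sum, map_mul, map_pow, map_prod, map_sub, map_one, aeval_X, Finset.mul_sum]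
    refine Finset.sum_congr rfl fun s _ => ?_
    rw [← Finset.mul_prod_erase univ _ (Finset.mem_univ s)]
    field_simp [hne hν s]
  have hζ0 : aeval ζ g = 0 := by rw [hg hζ, h, mul_zero]
  have : NeZero p := NeZero.of_pos hp
  obtain ⟨i, -, hi, rfl⟩ := hζ.isPrimitiveRoot_iff.1 hμ
  have hdvd : minpoly ℤ ζ ∣ g := minpoly.isIntegrallyClosed_dvd (hζ.isIntegral hp) hζ0
  rw [hζ.minpoly_eq_pow_coprime hi] at hdvd
  have hμ0 : aeval (ζ ^ i) g = 0 := by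
    obtain ⟨q, hq⟩ := hdvd
    rw [hq, map_mul, minpoly.aeval, zero_mul]
  rw [hg hμ] at hμ0
  exact (mul_eq_zero.1 hμ0).resolve_left (Finset.prod_ne_zero_iff.2 fun s _ => hne hμ s)

open Polynomial in
/-- If `∑ s, ζ ^ a s / (1 - ζ ^ n s)` vanishes at a primitive `p`-th root of unity, then there are
more than `φ p` complex numbers that are `n s`-th roots of unity for some `s`. -/
theorem totient_lt_card_biUnion_nthRootsFinset {ι : Type*} [Fintype ι] [Nonempty ι] (a n : ι → ℕ)
    (ha : ∀ s, a s < n s) {p : ℕ} (hp : 0 < p) (hpn : ∀ s, ¬ p ∣ n s) {ζ : ℂ}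
    (hζ : IsPrimitiveRoot ζ p) (h : ∑ s, ζ ^ a s / (1 - ζ ^ n s) = 0) :
    p.totient < (univ.biUnion fun s => nthRootsFinset (n s) (1 : ℂ)).card := by
  set T : Finset ℂ := univ.biUnion fun s => nthRootsFinset (n s) (1 : ℂ) with hT
  have hn : ∀ s, 0 < n s := fun s => (Nat.zero_le _).trans_lt (ha s)
  have hsub : ∀ s, nthRootsFinset (n s) (1 : ℂ) ⊆ T := fun s =>
    Finset.subset_biUnion_of_mem (fun s => nthRootsFinset (n s) (1 : ℂ)) (Finset.mem_univ s)
  have hcard : ∀ s, (nthRootsFinset (n s) (1 : ℂ)).card = n s := fun s =>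
    (Complex.isPrimitiveRoot_exp _ (hn s).ne').card_nthRootsFinset
  let Q : ℂ[X] := ∏ z ∈ T, (X - C z)
  let q : ι → ℂ[X] := fun s => ∏ z ∈ T \ nthRootsFinset (n s) (1 : ℂ), (X - C z)
  have hq : ∀ s, q s * (X ^ n s - 1) = Q := fun s => by
    rw [X_pow_sub_one_eq_prod (hn s) (Complex.isPrimitiveRoot_exp _ (hn s).ne')]
    exact Finset.prod_sdiff (hsub s)
  let P : ℂ[X] := ∑ s, X ^ a s * q s
  have hP : ∀ x : ℂ, (∀ s, 1 - x ^ n s ≠ 0) →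
      P.eval x = -(Q.eval x * ∑ s, x ^ a s / (1 - x ^ n s)) := by
    intro x hx
    simp only [P, eval_finsetSum, eval_mul, eval_pow, eval_X, Finset.mul_sum,
      ← Finset.sum_neg_distrib]
    refine Finset.sum_congr rfl fun s _ => ?_
    have := hx s
    rw [← hq s]
    simp only [eval_mul, eval_sub, eval_pow, eval_X, eval_one]
    field_simp
    ring
  have hP0 : P ≠ 0 := by
    intro h0
    have hlt : ∀ s, (1 / 2 : ℝ) ^ n s < 1 := fun s =>
      pow_lt_one₀ (by norm_num) (by norm_num) (hn s).ne'
    have hx : ∀ s, 1 - ((1 / 2 : ℝ) : ℂ) ^ n s ≠ 0 := fun s => by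
      exact_mod_cast (sub_pos.2 (hlt s)).ne'
    have he := hP _ hx
    rw [h0, eval_zero, eq_comm, neg_eq_zero] at he
    rcases mul_eq_zero.1 he with he | he
    · rw [eval_prod, Finset.prod_eq_zero_iff] at he
      obtain ⟨z, hz, hz0⟩ := he
      obtain ⟨s, -, hs⟩ := Finset.mem_biUnion.1 hz
      rw [mem_nthRootsFinset (hn s)] at hs
      rw [eval_sub, eval_X, eval_C, sub_eq_zero] at hz0
      exact hx s (by rw [hz0, hs, sub_self])
    · have hpos : 0 < ∑ s, (1 / 2 : ℝ) ^ a s / (1 - (1 / 2 : ℝ) ^ n s) :=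
        Finset.sum_pos (fun s _ => div_pos (by positivity) (sub_pos.2 (hlt s)))
          Finset.univ_nonempty
      exact hpos.ne' (by exact_mod_cast he)
  have hdeg : P.degree < T.card := by
    refine (degree_sum_le _ _).trans_lt ((Finset.sup_lt_iff ?_).2 fun s _ => ?_)
    · exact WithBot.bot_lt_coe _
    · rw [degree_mul, degree_X_pow, degree_prod_of_monic _ _ fun z _ => monic_X_sub_C z]
      simp only [degree_X_sub_C, Finset.sum_const, nsmul_eq_mul, mul_one]
      rw [Finset.card_sdiff_of_subset (hsub s), hcard]
      have h1 := Finset.card_le_card (hsub s)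
      rw [hcard] at h1
      have h2 := ha s
      exact_mod_cast (by omega : a s + (T.card - n s) < T.card)
  rw [← Complex.card_primitiveRoots p]
  by_contra! hle
  refine hP0 (eq_zero_of_degree_lt_of_eval_finset_eq_zero (primitiveRoots p ℂ)
    (hdeg.trans_le (by exact_mod_cast hle)) fun μ hμ => ?_)
  have hμ' := (mem_primitiveRoots hp).1 hμ
  rw [hP μ fun s h0 => hpn s ((hμ'.pow_eq_one_iff_dvd _).1 (sub_eq_zero.1 h0).symm),
    sum_pow_div_one_sub_pow_eq_zero_of_isPrimitiveRoot a n hp hpn hζ hμ' h, mul_zero, neg_zero]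

/-- There are at most as many roots of unity as there are fractions `r / n s` in `[0, 1)`. -/
theorem card_biUnion_nthRootsFinset_le {ι : Type*} [Fintype ι] (n : ι → ℕ) (hn : ∀ s, 0 < n s) :
    (univ.biUnion fun s => Polynomial.nthRootsFinset (n s) (1 : ℂ)).card ≤
      ((univ : Finset ι).biUnion fun s =>
        (range (n s)).image fun r : ℕ => (r : ℚ) / (n s : ℚ)).card := by
  refine (Finset.card_le_card ?_).trans
    (Finset.card_image_le (f := fun θ : ℚ => Complex.exp (2 * π * I * (θ : ℂ))))
  intro z hz
  obtain ⟨s, -, hs⟩ := Finset.mem_biUnion.1 hz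
  rw [Polynomial.mem_nthRootsFinset (hn s)] at hs
  have : NeZero (n s) := ⟨(hn s).ne'⟩
  obtain ⟨r, hr, rfl⟩ :=
    (Complex.isPrimitiveRoot_exp _ (hn s).ne').eq_pow_of_pow_eq_one hs
  refine Finset.mem_image.2 ⟨r / n s, Finset.mem_biUnion.2 ⟨s, Finset.mem_univ s,
    Finset.mem_image_of_mem _ (Finset.mem_range.2 hr)⟩, ?_⟩
  rw [← Complex.exp_nat_mul]
  push_cast
  ring_nf

theorem card_image_range_div {m : ℕ} (hm : 0 < m) :
    ((range m).image fun r : ℕ => (r : ℚ) / (m : ℚ)).card = m := by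
  have hm' : (m : ℚ) ≠ 0 := by exact_mod_cast hm.ne'
  rw [Finset.card_image_of_injective, Finset.card_range]
  exact fun x y hxy => by exact_mod_cast (div_left_inj' hm').1 hxy

theorem card_biUnion_image_range_div_le {ι : Type*} [Fintype ι] (n : ι → ℕ)
    (hn : ∀ s, 0 < n s) :
    (((univ : Finset ι).biUnion fun s =>
        (range (n s)).image fun r : ℕ => (r : ℚ) / (n s : ℚ)).card : ℤ) ≤
      (∑ s, (n s : ℤ)) - Fintype.card ι + 1 := by
  have hzero : ∀ s, (0 : ℚ) ∈ (range (n s)).image fun r : ℕ => (r : ℚ) / (n s : ℚ) := fun s =>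
    Finset.mem_image.2 ⟨0, Finset.mem_range.2 (hn s), by simp⟩
  have hle : ((univ : Finset ι).biUnion fun s =>
      (range (n s)).image fun r : ℕ => (r : ℚ) / (n s : ℚ)).card ≤ (∑ s, (n s - 1)) + 1 := by
    rw [← Nat.sub_le_iff_le_add]
    refine Finset.pred_card_le_card_erase (a := (0 : ℚ)).trans ?_
    rw [Finset.erase_biUnion]
    refine Finset.card_biUnion_le.trans (Finset.sum_le_sum fun s _ => ?_)
    rw [Finset.card_erase_of_mem (hzero s), card_image_range_div (hn s)]
  have hsum : ((∑ s, (n s - 1) : ℕ) : ℤ) = (∑ s, (n s : ℤ)) - Fintype.card ι := by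
    rw [Nat.cast_sum, Finset.sum_congr rfl fun s _ => Nat.cast_sub (R := ℤ) (hn s)]
    simp
  rw [← hsum]
  exact_mod_cast hle

/-- The image of a monadic coercion of `range m` to `Finset ℚ` is the image under the cast. -/
theorem image_div_bind_pure_cast (m : ℕ) :
    ((range m >>= fun a : ℕ => pure (a : ℚ)).image fun r => r / (m : ℚ)) =
      (range m).image fun r : ℕ => (r : ℚ) / (m : ℚ) := by
  ext x
  simp [Finset.bind_def]

/-- **Corollary 1.2** (Pan–Sun). If a nonempty system `{a_s (mod n_s)}_{s=1}^k`
(with `0 ≤ a_s < n_s`) satisfies `∑_s e^{2πi a_s/p}/(1 − e^{2πi n_s/p}) = 0`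
for some prime `p`, then `n_1 + ⋯ + n_k − k + 1 ≥ |S(n_1,…,n_k)| ≥ p`. -/
theorem card_S_ge_prime
    {k : ℕ} (hk : 1 ≤ k) (a n : Fin k → ℕ)
    (hn : ∀ s, 0 < n s) (ha : ∀ s, a s < n s)
    (p : ℕ) (hp : p.Prime)
    (hsum : ∑ s, Complex.exp (2 * π * I * (a s : ℂ) / (p : ℂ)) /
              (1 - Complex.exp (2 * π * I * (n s : ℂ) / (p : ℂ))) = 0) :
    ((∑ s, (n s : ℤ)) - (k : ℤ) + 1 ≥
        ((((univ : Finset (Fin k)).biUnion fun s =>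
            (range (n s)).image fun r => (r : ℚ) / (n s : ℚ))).card : ℤ)) ∧
    ((((univ : Finset (Fin k)).biUnion fun s =>
        (range (n s)).image fun r => (r : ℚ) / (n s : ℚ))).card : ℤ) ≥ (p : ℤ) := by
  simp only [image_div_bind_pure_cast]
  refine ⟨by simpa using card_biUnion_image_range_div_le n hn, ?_⟩
  by_cases hpn : ∃ s, p ∣ n s
  · obtain ⟨s, hs⟩ := hpn
    have hcard := Finset.card_le_card (Finset.subset_biUnion_of_mem
      (fun s => (range (n s)).image fun r : ℕ => (r : ℚ) / (n s : ℚ)) (Finset.mem_univ s))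
    rw [card_image_range_div (hn s)] at hcard
    exact_mod_cast (Nat.le_of_dvd (hn s) hs).trans hcard
  · push Not at hpn
    have : Nonempty (Fin k) := ⟨⟨0, hk⟩⟩
    have hpow : ∀ m : ℕ, Complex.exp (2 * π * I * (m : ℂ) / (p : ℂ)) =
        Complex.exp (2 * π * I / p) ^ m := fun m => by
      rw [← Complex.exp_nat_mul]
      ring_nf
    simp only [hpow] at hsum
    have hlt := totient_lt_card_biUnion_nthRootsFinset a n ha hp.pos hpn
      (Complex.isPrimitiveRoot_exp p hp.ne_zero) hsum
    have hle := hlt.trans_le (card_biUnion_nthRootsFinset_le n hn)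
    rw [Nat.totient_prime hp] at hle
    exact_mod_cast Nat.le_of_pred_lt hle
end

section
/- Let A = {a_s (mod n_s)}_{s=1}^k and B = {b_t (mod m_t)}_{t=1}^l be finite systems of residue classes with 0 ≤ a_s < n_s and 0 ≤ b_t < m_t, such that n_1,...,n_k are pairwise distinct and m_1,...,m_l are pairwise distinct. Let p be a prime greater than |S(n_1,...,n_k,m_1,...,m_l)|, and let ζ_p be a primitive p-th root of unity. Then A and B are identical (i.e., k = l and the multiset of pairs {(a_s, n_s)} equals the multiset {(b_t, m_t)}) if and only if Σ_{s=1}^k ζ_p^{a_s}/(1 − ζ_p^{n_s}) = Σ_{t=1}^l ζ_p^{b_t}/(1 − ζ_p^{m_t}). -/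
open Finset Polynomial
open scoped Classical

/-- The orders of the roots of unity that are `N`-th roots of unity for some `N ∈ T`. -/
def rootOrders (T : Finset ℕ) : Finset ℕ := T.biUnion Nat.divisors

lemma mem_rootOrders {T : Finset ℕ} {d : ℕ} :
    d ∈ rootOrders T ↔ ∃ N ∈ T, d ∣ N ∧ N ≠ 0 := by
  simp [rootOrders]

/-- The least common multiple of the polynomials `X ^ N - 1`, `N ∈ T`, divided by `X ^ N - 1`. -/
noncomputable def cofactor (T : Finset ℕ) (N : ℕ) : ℚ[X] :=
  ∏ d ∈ rootOrders T \ N.divisors, cyclotomic d ℚ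

lemma cofactor_mul {T : Finset ℕ} {N : ℕ} (hN : N ∈ T) (h0 : 0 < N) :
    cofactor T N * (X ^ N - 1) = ∏ d ∈ rootOrders T, cyclotomic d ℚ := by
  rw [← prod_cyclotomic_eq_X_pow_sub_one h0, cofactor]
  exact prod_sdiff (subset_biUnion_of_mem Nat.divisors hN)

lemma cofactor_ne_zero (T : Finset ℕ) (N : ℕ) : cofactor T N ≠ 0 :=
  prod_ne_zero_iff.2 fun d _ => cyclotomic_ne_zero d ℚ

lemma sum_totient_rootOrders_le (T : Finset ℕ) :
    ∑ d ∈ rootOrders T, d.totient ≤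
      (T.biUnion fun N => (range N).image fun r : ℕ => (r : ℚ) / (N : ℚ)).card := by
  simp only [Nat.totient_eq_card_coprime]
  rw [← card_sigma]
  refine card_le_card_of_injOn (fun x => (x.2 : ℚ) / (x.1 : ℚ)) ?_ ?_
  · rintro ⟨d, r⟩ h
    simp only [coe_sigma, Set.mem_sigma_iff, mem_coe, mem_filter, mem_range, mem_rootOrders] at h
    obtain ⟨⟨N, hN, ⟨q, rfl⟩, h0⟩, hr, -⟩ := h
    simp only [coe_biUnion, Set.mem_iUnion, mem_coe, mem_image, mem_range]
    have hd : (d : ℚ) ≠ 0 := by exact_mod_cast left_ne_zero_of_mul h0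
    have hq : q ≠ 0 := right_ne_zero_of_mul h0
    refine ⟨d * q, hN, r * q, Nat.mul_lt_mul_of_pos_right hr (Nat.pos_of_ne_zero hq), ?_⟩
    have hq' : (q : ℚ) ≠ 0 := by exact_mod_cast hq
    push_cast
    field_simp
  · rintro ⟨d, r⟩ h ⟨d', r'⟩ h' he
    simp only [coe_sigma, Set.mem_sigma_iff, mem_coe, mem_filter, mem_range] at h h'
    have key : (r : ℤ) = r' ∧ (d : ℤ) = d' :=
      Rat.div_int_inj (by exact_mod_cast (by lia : 0 < d)) (by exact_mod_cast (by lia : 0 < d'))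
        (by simpa using h.2.2.symm) (by simpa using h'.2.2.symm) (by simpa using he)
    obtain ⟨h1, h2⟩ := key
    obtain rfl : r = r' := by exact_mod_cast h1
    obtain rfl : d = d' := by exact_mod_cast h2
    rfl

lemma sum_mul_cofactor_eq_zero {T : Finset ℕ} (hT : ∀ N ∈ T, 0 < N) {c : ℕ → ℚ[X]}
    (hc : ∀ N ∈ T, (c N).degree < N) {p : ℕ} (hp : p.Prime) (hTp : ∀ N ∈ T, N < p)
    (hlt : ∑ d ∈ rootOrders T, d.totient < p) {ζ : ℂ} (hζ : IsPrimitiveRoot ζ p)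
    (h : ∑ N ∈ T, aeval ζ (c N) / (1 - ζ ^ N) = 0) :
    ∑ N ∈ T, c N * cofactor T N = 0 := by
  set D : ℚ[X] := ∏ d ∈ rootOrders T, cyclotomic d ℚ with hD
  have hdeg : D.degree = (∑ d ∈ rootOrders T, d.totient : ℕ) := by
    simp [hD, degree_prod, degree_cyclotomic]
  have hsum : (∑ N ∈ T, c N * cofactor T N).degree < D.degree := by
    rw [hdeg, ← mem_degreeLT]
    refine sum_mem fun N hN => ?_
    rw [mem_degreeLT, ← hdeg, hD, ← cofactor_mul hN (hT N hN), mul_comm, degree_mul, degree_mul,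
      ← C_1, degree_X_pow_sub_C (hT N hN)]
    exact WithBot.add_lt_add_left (degree_ne_bot.2 (cofactor_ne_zero T N)) (hc N hN)
  have hroot : aeval ζ (∑ N ∈ T, c N * cofactor T N) = 0 := by
    have hmul : aeval ζ (∑ N ∈ T, c N * cofactor T N) =
        -aeval ζ D * ∑ N ∈ T, aeval ζ (c N) / (1 - ζ ^ N) := by
      rw [map_sum, mul_sum]
      refine sum_congr rfl fun N hN => ?_
      have h1 : 1 - ζ ^ N ≠ 0 := sub_ne_zero.2
        (hζ.pow_ne_one_of_pos_of_lt (hT N hN).ne' (hTp N hN)).symm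
      rw [hD, ← cofactor_mul hN (hT N hN)]
      simp only [map_mul, map_sub, map_pow, aeval_X, map_one]
      field_simp
      ring
    rw [hmul, h, mul_zero]
  refine eq_zero_of_dvd_of_degree_lt (minpoly.dvd ℚ ζ hroot) (hsum.trans_le ?_)
  rw [← cyclotomic_eq_minpoly_rat hζ hp.pos, degree_cyclotomic, Nat.totient_prime hp, hdeg]
  exact_mod_cast Nat.le_sub_one_of_lt hlt

lemma eq_zero_of_sum_mul_cofactor_eq_zero {T : Finset ℕ} (hT : ∀ N ∈ T, 0 < N) {c : ℕ → ℚ[X]}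
    (hc : ∀ N ∈ T, ∀ ω : ℂ, IsPrimitiveRoot ω N → aeval ω (c N) = 0 → c N = 0)
    (h : ∑ N ∈ T, c N * cofactor T N = 0) : ∀ N ∈ T, c N = 0 := by
  by_contra! hne
  obtain ⟨N₀, hN₀, hcN₀⟩ := hne
  obtain ⟨M, hM, hmax⟩ := exists_max_image (T.filter fun N => c N ≠ 0) id
    ⟨N₀, mem_filter.2 ⟨hN₀, hcN₀⟩⟩
  obtain ⟨hMT, hcM⟩ := mem_filter.1 hM
  have hω := Complex.isPrimitiveRoot_exp M (hT M hMT).ne'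
  set ω := Complex.exp (2 * Real.pi * Complex.I / M)
  have hcyc (d : ℕ) (hd : 0 < d) : aeval ω (cyclotomic d ℚ) = 0 ↔ d = M := by
    have : NeZero (d : ℂ) := ⟨by exact_mod_cast hd.ne'⟩
    rw [aeval_def, ← eval_map, map_cyclotomic, ← IsRoot.def, isRoot_cyclotomic_iff]
    exact ⟨fun h' => h'.unique hω, fun h' => h' ▸ hω⟩
  have hcof (N : ℕ) (hN : 0 < N) : aeval ω (cofactor T N) = 0 ↔ ¬ M ∣ N := by
    rw [cofactor, map_prod, prod_eq_zero_iff]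
    constructor
    · rintro ⟨d, hd, hd0⟩
      obtain ⟨hdT, hdN⟩ := mem_sdiff.1 hd
      obtain ⟨N', -, hdvd, hN'⟩ := mem_rootOrders.1 hdT
      rw [hcyc d (Nat.pos_of_dvd_of_pos hdvd (Nat.pos_of_ne_zero hN'))] at hd0
      simpa [← hd0, hN.ne'] using hdN
    · intro hMN
      exact ⟨M, mem_sdiff.2 ⟨mem_rootOrders.2 ⟨M, hMT, dvd_rfl, (hT M hMT).ne'⟩,
        by simp [hMN]⟩, (hcyc M (hT M hMT)).2 rfl⟩
  have hval := congrArg (aeval ω) h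
  rw [map_sum, map_zero, sum_eq_single_of_mem M hMT, map_mul, mul_eq_zero] at hval
  · exact hcM (hc M hMT ω hω (hval.resolve_right fun h' => (hcof M (hT M hMT)).1 h' dvd_rfl))
  · intro N hN hNM
    rw [map_mul, mul_eq_zero]
    by_cases hcN : c N = 0
    · simp [hcN]
    · refine Or.inr ((hcof N (hT N hN)).2 fun hdvd => hNM (le_antisymm ?_ ?_))
      · exact hmax N (mem_filter.2 ⟨hN, hcN⟩)
      · exact Nat.le_of_dvd (hT N hN) hdvd

/-- The sum of the monomials `X ^ a s` over the residue classes `a s (mod n s)` of modulus `N`. -/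
noncomputable def residuePoly {k : ℕ} (a n : Fin k → ℕ) (N : ℕ) : ℚ[X] :=
  ∑ s with n s = N, X ^ a s

section residuePoly

variable {k : ℕ} {a n : Fin k → ℕ}

lemma residuePoly_apply (hn : Function.Injective n) (s : Fin k) :
    residuePoly a n (n s) = X ^ a s := by
  simp [residuePoly, hn.eq_iff, filter_eq']

lemma residuePoly_eq_zero {N : ℕ} (h : ∀ s, n s ≠ N) : residuePoly a n N = 0 := by
  simp [residuePoly, h]

lemma degree_residuePoly_lt (ha : ∀ s, a s < n s) (N : ℕ) : (residuePoly a n N).degree < N := by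
  rw [← mem_degreeLT]
  refine sum_mem fun s hs => ?_
  rw [mem_degreeLT, degree_X_pow]
  exact_mod_cast (mem_filter.1 hs).2 ▸ ha s

lemma sum_aeval_residuePoly {T : Finset ℕ} (hT : ∀ s, n s ∈ T) (ζ : ℂ) :
    ∑ N ∈ T, aeval ζ (residuePoly a n N) / (1 - ζ ^ N) = ∑ s, ζ ^ a s / (1 - ζ ^ n s) := by
  rw [← sum_fiberwise_of_maps_to (t := T) (g := n) fun s _ => hT s]
  refine sum_congr rfl fun N _ => ?_
  rw [residuePoly, map_sum, sum_div]
  refine sum_congr rfl fun s hs => ?_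
  simp [(mem_filter.1 hs).2]

end residuePoly

/-- A difference of polynomials attached to two systems with distinct moduli vanishes as soon as
it vanishes at a primitive `N`-th root of unity. -/
lemma residuePoly_sub_eq_zero {k l : ℕ} {a n : Fin k → ℕ} {b m : Fin l → ℕ}
    (ha : ∀ s, a s < n s) (hb : ∀ t, b t < m t)
    (hn : Function.Injective n) (hm : Function.Injective m) {N : ℕ} (hN : 0 < N)
    {ω : ℂ} (hω : IsPrimitiveRoot ω N)
    (h : aeval ω (residuePoly a n N - residuePoly b m N) = 0) :
    residuePoly a n N - residuePoly b m N = 0 := by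
  have hω0 : ω ≠ 0 := hω.ne_zero hN.ne'
  by_cases h1 : ∃ s, n s = N <;> by_cases h2 : ∃ t, m t = N
  · obtain ⟨s, rfl⟩ := h1
    obtain ⟨t, ht⟩ := h2
    rw [residuePoly_apply hn, ← ht, residuePoly_apply hm] at h ⊢
    rw [map_sub, map_pow, map_pow, aeval_X, sub_eq_zero] at h
    rw [hω.pow_inj (ha s) (ht ▸ hb t) h, sub_self]
  · obtain ⟨s, rfl⟩ := h1
    push Not at h2
    simp [residuePoly_apply hn, residuePoly_eq_zero h2, hω0] at h
  · obtain ⟨t, rfl⟩ := h2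
    push Not at h1
    simp [residuePoly_apply hm, residuePoly_eq_zero h1, hω0] at h
  · push Not at h1 h2
    rw [residuePoly_eq_zero h1, residuePoly_eq_zero h2, sub_self]

lemma exists_eq_of_residuePoly_eq {k l : ℕ} {a n : Fin k → ℕ} {b m : Fin l → ℕ}
    (hn : Function.Injective n) (hm : Function.Injective m) (s : Fin k)
    (h : residuePoly a n (n s) = residuePoly b m (n s)) : ∃ t, a s = b t ∧ n s = m t := by
  rw [residuePoly_apply hn] at h
  by_cases h2 : ∃ t, m t = n s
  · obtain ⟨t, ht⟩ := h2
    rw [← ht, residuePoly_apply hm] at h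
    exact ⟨t, by simpa using congrArg natDegree h, ht.symm⟩
  · push Not at h2
    simp [residuePoly_eq_zero h2] at h

/-- **Corollary 1.3** (Pan–Sun). Let `A = {a_s (mod n_s)}_{s=1}^k` and
`B = {b_t (mod m_t)}_{t=1}^l` (with `0 ≤ a_s < n_s`, `0 ≤ b_t < m_t`) both have
distinct moduli.  Let `p` be a prime greater than `|S(n_1,…,n_k,m_1,…,m_l)|`
and let `ζ` be a primitive `p`-th root of unity.  Then `A` and `B` are
identical (as multisets of residue classes) iff
`∑_s ζ^{a_s}/(1−ζ^{n_s}) = ∑_t ζ^{b_t}/(1−ζ^{m_t})`. -/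
theorem identical_iff
    {k l : ℕ} (a n : Fin k → ℕ) (b m : Fin l → ℕ)
    (hn : ∀ s, 0 < n s) (ha : ∀ s, a s < n s)
    (hm : ∀ t, 0 < m t) (hb : ∀ t, b t < m t)
    (hndist : Function.Injective n) (hmdist : Function.Injective m)
    (p : ℕ) (hp : p.Prime)
    (hpS : (((univ : Finset (Fin k)).biUnion fun s =>
               (range (n s)).image fun r => (r : ℚ) / (n s : ℚ)) ∪
            ((univ : Finset (Fin l)).biUnion fun t =>
               (range (m t)).image fun r => (r : ℚ) / (m t : ℚ))).card < p)
    (ζ : ℂ) (hζ : IsPrimitiveRoot ζ p) :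
    (∃ e : Fin k ≃ Fin l, ∀ s, a s = b (e s) ∧ n s = m (e s)) ↔
    ∑ s, ζ ^ (a s) / (1 - ζ ^ (n s)) = ∑ t, ζ ^ (b t) / (1 - ζ ^ (m t)) := by
  constructor
  · rintro ⟨e, he⟩
    rw [← e.sum_comp]
    exact sum_congr rfl fun s _ => by rw [(he s).1, (he s).2]
  intro h
  set T : Finset ℕ := univ.image n ∪ univ.image m with hTdef
  have hnT (s) : n s ∈ T := by simp [hTdef]
  have hmT (t) : m t ∈ T := by simp [hTdef]
  have hT : ∀ N ∈ T, 0 < N := by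
    intro N hN
    simp only [hTdef, mem_union, mem_image, mem_univ, true_and] at hN
    rcases hN with ⟨s, rfl⟩ | ⟨t, rfl⟩
    exacts [hn s, hm t]
  have hS : (T.biUnion fun N => (range N).image fun r : ℕ => (r : ℚ) / (N : ℚ)).card < p := by
    rw [hTdef, union_biUnion, image_biUnion, image_biUnion]
    have hlift (N : ℕ) :
        ((range N).image fun r => (r : ℚ) / (N : ℚ)) =
          (range N).image fun r : ℕ => (r : ℚ) / (N : ℚ) := by
      ext x
      simp
    simpa only [hlift] using hpS
  have hTp : ∀ N ∈ T, N < p := by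
    intro N hN
    refine lt_of_le_of_lt ?_ hS
    have hN0 : (N : ℚ) ≠ 0 := by exact_mod_cast (hT N hN).ne'
    calc N = ((range N).image fun r : ℕ => (r : ℚ) / (N : ℚ)).card := by
          rw [card_image_of_injective, card_range]
          intro r r' hr
          exact_mod_cast (div_left_inj' hN0).1 hr
      _ ≤ _ := card_le_card
          (subset_biUnion_of_mem (fun N : ℕ => (range N).image fun r : ℕ => (r : ℚ) / (N : ℚ)) hN)
  have hzero : ∀ N ∈ T, residuePoly a n N - residuePoly b m N = 0 := by
    refine eq_zero_of_sum_mul_cofactor_eq_zero hT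
      (fun N hN ω hω => residuePoly_sub_eq_zero ha hb hndist hmdist (hT N hN) hω)
      (sum_mul_cofactor_eq_zero hT (fun N _ => ?_) hp hTp
        ((sum_totient_rootOrders_le T).trans_lt hS) hζ ?_)
    · exact (degree_sub_le _ _).trans_lt
        (max_lt (degree_residuePoly_lt ha N) (degree_residuePoly_lt hb N))
    · simp only [map_sub, sub_div, sum_sub_distrib]
      rw [sum_aeval_residuePoly hnT, sum_aeval_residuePoly hmT, h, sub_self]
  choose f hfa hfn using fun s =>
    exists_eq_of_residuePoly_eq hndist hmdist s (sub_eq_zero.1 (hzero _ (hnT s)))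
  refine ⟨Equiv.ofBijective f ⟨fun s s' hs => hndist ?_, fun t => ?_⟩, fun s => ⟨hfa s, hfn s⟩⟩
  · rw [hfn, hfn, hs]
  · obtain ⟨s, -, hs⟩ :=
      exists_eq_of_residuePoly_eq hmdist hndist t (sub_eq_zero.1 (hzero _ (hmT t))).symm
    exact ⟨s, hmdist ((hfn s).symm.trans hs.symm)⟩
end

section
/- Let 𝒜 = {⟨λ_s, a_s, n_s⟩}_{s=1}^k where λ_s, a_s, n_s are integers with n_s ≥ 1 and 0 ≤ a_s < n_s. Let p be a prime with p > |S(n_1,...,n_k)|, and let ζ_p be any primitive p-th root of unity. Then the weighted covering function w_𝒜(x) = Σ_{1 ≤ s ≤ k, n_s | x − a_s} λ_s vanishes for all x ∈ ℤ if and only if Σ_{s=1}^k λ_s ζ_p^{a_s}/(1 − ζ_p^{n_s}) = 0. -/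
open Finset
open scoped Classical

section Helpers

open Polynomial

/-- The generating function of the residue class `a` modulo `n` is `X ^ a / (1 - X ^ n)`. -/
lemma PowerSeries.one_sub_X_pow_mul_mk_residueClass {a n : ℕ} (h : a < n) :
    (1 - PowerSeries.X ^ n) *
      PowerSeries.mk (fun x : ℕ => if (n : ℤ) ∣ (x : ℤ) - a then (1 : ℤ) else 0) =
      PowerSeries.X ^ a := by
  ext m
  rw [sub_mul, one_mul, map_sub, PowerSeries.coeff_X_pow_mul', PowerSeries.coeff_X_pow,
    PowerSeries.coeff_mk]
  by_cases hm : n ≤ m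
  · have hdvd : (n : ℤ) ∣ ((m - n : ℕ) : ℤ) - a ↔ (n : ℤ) ∣ (m : ℤ) - a := by
      rw [Nat.cast_sub hm, sub_right_comm, dvd_sub_self_right]
    rw [if_pos hm, PowerSeries.coeff_mk, if_neg (by omega : ¬m = a)]
    simp only [hdvd, sub_self]
  · have hdvd : (n : ℤ) ∣ (m : ℤ) - a ↔ m = a := by
      refine ⟨fun hd => ?_, fun e => by simp [e]⟩
      have := Int.eq_zero_of_abs_lt_dvd hd (by rw [abs_lt]; omega)
      omega
    rw [if_neg hm, sub_zero]
    simp only [hdvd]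

lemma sum_totient_divisors_le_card_fractions {ι : Type*} (A : Finset ι) (n : ι → ℕ) :
    ∑ d ∈ A.biUnion (fun s => (n s).divisors), d.totient ≤
      (A.biUnion fun s => (range (n s)).image fun r : ℕ => (r : ℚ) / (n s : ℚ)).card := by
  set S := A.biUnion fun s => (range (n s)).image fun r : ℕ => (r : ℚ) / (n s : ℚ)
  refine le_trans (Finset.sum_le_sum fun d hd => ?_)
    ((Finset.sum_card_fiberwise_eq_card_filter S _ Rat.den).trans_le (Finset.card_filter_le _ _))
  obtain ⟨s, hs, hds⟩ := Finset.mem_biUnion.1 hd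
  obtain ⟨⟨e, he⟩, hn⟩ := Nat.mem_divisors.1 hds
  have hd0 : 0 < d := Nat.pos_of_mem_divisors hds
  have he0 : 0 < e := Nat.pos_of_ne_zero fun h => hn (by rw [he, h, mul_zero])
  rw [Nat.totient_eq_card_coprime]
  refine Finset.card_le_card_of_injOn (fun r : ℕ => (r : ℚ) / d) (fun r hr => ?_)
    (fun r _ t _ h => ?_)
  · obtain ⟨hrd, hcop⟩ := Finset.mem_filter.1 hr
    refine Finset.mem_coe.2 (Finset.mem_filter.2 ⟨?_, ?_⟩)
    · refine Finset.mem_biUnion.2 ⟨s, hs, Finset.mem_image.2 ⟨r * e, ?_, ?_⟩⟩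
      · rw [Finset.mem_range] at hrd ⊢
        rw [he]
        exact Nat.mul_lt_mul_of_pos_right hrd he0
      · rw [he]
        push_cast
        exact mul_div_mul_right _ _ (by positivity)
    · have := Rat.den_div_eq_of_coprime (a := r) (b := d) (by exact_mod_cast hd0)
        (by simpa using hcop.symm)
      simp only [Int.cast_natCast] at this
      exact Int.ofNat_inj.1 this
  · have hd' : (d : ℚ) ≠ 0 := by positivity
    exact_mod_cast (div_left_inj' hd').1 h

lemma le_card_fractions {ι : Type*} (A : Finset ι) (n : ι → ℕ) {s : ι} (hs : s ∈ A) :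
    n s ≤ (A.biUnion fun s => (range (n s)).image fun r : ℕ => (r : ℚ) / (n s : ℚ)).card :=
  calc n s = ∑ d ∈ (n s).divisors, d.totient := (Nat.sum_totient _).symm
    _ ≤ ∑ d ∈ A.biUnion (fun s => (n s).divisors), d.totient :=
      Finset.sum_le_sum_of_subset (Finset.subset_biUnion_of_mem (fun s => (n s).divisors) hs)
    _ ≤ _ := sum_totient_divisors_le_card_fractions A n

/-- A weighted covering function that vanishes on `ℕ` vanishes on `ℤ`, by periodicity. -/
lemma weightedCover_zero_of_nat {ι : Type*} [Fintype ι] (lam : ι → ℤ) (a n : ι → ℕ)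
    (hn : ∀ s, 0 < n s)
    (h : ∀ x : ℕ, ∑ s with (n s : ℤ) ∣ (x : ℤ) - (a s : ℤ), lam s = 0) (x : ℤ) :
    ∑ s with (n s : ℤ) ∣ x - (a s : ℤ), lam s = 0 := by
  have hN : 0 < ∏ s, n s := Finset.prod_pos fun s _ => hn s
  have hy : 0 ≤ x + (∏ s, n s : ℕ) * |x| := by
    have h1 : (1 : ℤ) ≤ (∏ s, n s : ℕ) := by exact_mod_cast hN
    nlinarith [neg_abs_le x, abs_nonneg x]
  obtain ⟨y, hy⟩ := Int.eq_ofNat_of_zero_le hy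
  rw [← h y]
  refine Finset.sum_congr (Finset.filter_congr fun s _ => ?_) fun _ _ => rfl
  have hd : (n s : ℤ) ∣ (∏ s, n s : ℕ) * |x| :=
    Dvd.dvd.mul_right (Int.natCast_dvd_natCast.2 (Finset.dvd_prod_of_mem n (mem_univ s))) _
  rw [← hy, add_sub_right_comm, dvd_add_left hd]

/-- If `D = (X ^ n s - 1) * E s` for all `s`, the weighted covering function has generating
function `-(∑ s, lam s * X ^ a s * E s) / D`. -/
lemma weightedCover_zero_iff_numerator_eq_zero {ι : Type*} [Fintype ι] (lam : ι → ℤ)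
    (a n : ι → ℕ) (ha : ∀ s, a s < n s) {D : ℤ[X]} (hD : D ≠ 0) {E : ι → ℤ[X]}
    (hE : ∀ s, D = (X ^ n s - 1) * E s) :
    (∀ x : ℤ, ∑ s with (n s : ℤ) ∣ x - (a s : ℤ), lam s = 0) ↔
      ∑ s, C (lam s) * X ^ a s * E s = 0 := by
  set W : PowerSeries ℤ :=
    PowerSeries.mk fun x : ℕ => ∑ s with (n s : ℤ) ∣ (x : ℤ) - (a s : ℤ), lam s with hW
  have hWsum : W = ∑ s, PowerSeries.C (lam s) *
      PowerSeries.mk (fun x : ℕ => if (n s : ℤ) ∣ (x : ℤ) - a s then (1 : ℤ) else 0) := by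
    ext x
    simp only [hW, Finset.sum_filter, map_sum, PowerSeries.coeff_C_mul, PowerSeries.coeff_mk,
      mul_ite, mul_one, mul_zero]
  have hDW : (D : PowerSeries ℤ) * W =
      -((∑ s, C (lam s) * X ^ a s * E s : ℤ[X]) : PowerSeries ℤ) := by
    rw [hWsum, Finset.mul_sum, ← Polynomial.coeToPowerSeries.ringHom_apply (φ := ∑ s, _), map_sum,
      ← Finset.sum_neg_distrib]
    refine Finset.sum_congr rfl fun s _ => ?_
    rw [hE s]
    simp only [Polynomial.coeToPowerSeries.ringHom_apply, Polynomial.coe_mul, Polynomial.coe_sub,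
      Polynomial.coe_pow, Polynomial.coe_X, Polynomial.coe_one, Polynomial.coe_C]
    rw [← PowerSeries.one_sub_X_pow_mul_mk_residueClass (ha s)]
    ring
  have hD' : (D : PowerSeries ℤ) ≠ 0 := by simpa using hD
  have hW0 : W = 0 ↔ ∑ s, C (lam s) * X ^ a s * E s = 0 := by
    rw [← Polynomial.coe_eq_zero_iff (R := ℤ), ← neg_eq_zero (a := Polynomial.toPowerSeries _), ← hDW,
      mul_eq_zero, or_iff_right hD']
  rw [← hW0]
  refine ⟨fun h => ?_, fun h => weightedCover_zero_of_nat lam a n (fun s => (ha s).pos)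
    fun x => ?_⟩
  · ext x
    simpa [hW] using h x
  · simpa [hW] using congrArg (PowerSeries.coeff x) h

/-- A nonzero integer polynomial vanishing at a primitive `p`-th root of unity has degree at
least `p - 1`. -/
lemma IsPrimitiveRoot.eq_zero_of_degree_lt_of_aeval_eq_zero {K : Type*} [Field K] [CharZero K]
    {p : ℕ} (hp : 0 < p) {ζ : K} (hζ : IsPrimitiveRoot ζ p) {P : ℤ[X]}
    (hdeg : P.degree < (p.totient : ℕ)) (h : aeval ζ P = 0) : P = 0 := by
  refine Polynomial.eq_zero_of_dvd_of_degree_lt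
    (minpoly.isIntegrallyClosed_dvd (hζ.isIntegral hp) h) ?_
  rwa [← Polynomial.cyclotomic_eq_minpoly hζ hp, Polynomial.degree_cyclotomic]

end Helpers

/-- **Theorem 1.2** (Pan–Sun). Let `𝒜 = {⟨λ_s, a_s, n_s⟩}_{s=1}^k` with
`λ_s, a_s, n_s ∈ ℤ`, `n_s ≥ 1` and `0 ≤ a_s < n_s`.  Let `p > |S(n_1,…,n_k)|`
be a prime and let `ζ` be any primitive `p`-th root of unity.  Then the
weighted covering function `w_𝒜(x) = ∑_{n_s ∣ x − a_s} λ_s` vanishes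
identically iff `∑_s λ_s ζ^{a_s}/(1 − ζ^{n_s}) = 0`. -/
theorem weighted_cover_zero_iff
    {k : ℕ} (lam : Fin k → ℤ) (a n : Fin k → ℕ)
    (hn : ∀ s, 0 < n s) (ha : ∀ s, a s < n s)
    (p : ℕ) (hp : p.Prime)
    (hpS : (((univ : Finset (Fin k)).biUnion fun s =>
               (range (n s)).image fun r => (r : ℚ) / (n s : ℚ))).card < p)
    (ζ : ℂ) (hζ : IsPrimitiveRoot ζ p) :
    (∀ x : ℤ, ∑ s ∈ (univ : Finset (Fin k)).filter
        (fun s => (n s : ℤ) ∣ x - (a s : ℤ)), lam s = 0) ↔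
    ∑ s, (lam s : ℂ) * ζ ^ (a s) / (1 - ζ ^ (n s)) = 0 := by
  replace hpS : ((univ : Finset (Fin k)).biUnion fun s =>
      (range (n s)).image fun r : ℕ => (r : ℚ) / (n s : ℚ)).card < p := by
    convert hpS using 4 with s
    ext x
    simp
  have hnp : ∀ s, n s < p := fun s =>
    (le_card_fractions univ n (mem_univ s)).trans_lt hpS
  have hζn : ∀ s, ζ ^ n s - 1 ≠ 0 := fun s h =>
    hζ.pow_ne_one_of_pos_of_lt (hn s).ne' (hnp s) (sub_eq_zero.1 h)
  set T := (univ : Finset (Fin k)).biUnion fun s => (n s).divisors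
  set D : Polynomial ℤ := ∏ d ∈ T, Polynomial.cyclotomic d ℤ with hD
  set E : Fin k → Polynomial ℤ := fun s =>
    ∏ d ∈ T \ (n s).divisors, Polynomial.cyclotomic d ℤ
  have hDE : ∀ s, D = (Polynomial.X ^ n s - 1) * E s := fun s => by
    rw [← Polynomial.prod_cyclotomic_eq_X_pow_sub_one (hn s), mul_comm]
    exact (Finset.prod_sdiff
      (Finset.subset_biUnion_of_mem (fun s => (n s).divisors) (mem_univ s))).symm
  have hDmonic : D.Monic :=
    Polynomial.monic_prod_of_monic _ _ fun d _ => Polynomial.cyclotomic.monic d ℤ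
  have hDdeg : D.natDegree < p := by
    rw [hD, Polynomial.natDegree_prod_of_monic _ _ fun d _ => Polynomial.cyclotomic.monic d ℤ]
    simp only [Polynomial.natDegree_cyclotomic]
    exact (sum_totient_divisors_le_card_fractions univ n).trans_lt hpS
  have hDζ : Polynomial.aeval ζ D ≠ 0 := by
    rw [hD, map_prod, Finset.prod_ne_zero_iff]
    intro d hd h
    obtain ⟨s, -, hds⟩ := Finset.mem_biUnion.1 hd
    obtain ⟨q, hq⟩ := Polynomial.cyclotomic.dvd_X_pow_sub_one d ℤ |>.trans
      (pow_one_sub_dvd_pow_mul_sub_one Polynomial.X d (n s / d))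
    rw [Nat.mul_div_cancel' (Nat.dvd_of_mem_divisors hds)] at hq
    refine hζn s ?_
    simpa [h] using congrArg (Polynomial.aeval ζ) hq
  rw [weightedCover_zero_iff_numerator_eq_zero lam a n ha hDmonic.ne_zero hDE]
  set P : Polynomial ℤ := ∑ s, Polynomial.C (lam s) * Polynomial.X ^ a s * E s with hP
  have hPζ : Polynomial.aeval ζ P =
      -Polynomial.aeval ζ D * ∑ s, (lam s : ℂ) * ζ ^ a s / (1 - ζ ^ n s) := by
    rw [hP, map_sum, Finset.mul_sum]
    refine Finset.sum_congr rfl fun s _ => ?_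
    have h1 : 1 - ζ ^ n s ≠ 0 := fun h => hζn s (by linear_combination -h)
    rw [hDE s]
    simp only [map_mul, map_sub, map_pow, map_one, Polynomial.aeval_X, eq_intCast, map_intCast]
    field_simp
    ring
  have hPdeg : P.degree < (p.totient : ℕ) := by
    rw [Nat.totient_prime hp]
    refine (Polynomial.degree_sum_le _ _).trans_lt
      ((Finset.sup_lt_iff (WithBot.bot_lt_coe _)).2 fun s _ => ?_)
    have hEmonic : (E s).Monic :=
      Polynomial.monic_prod_of_monic _ _ fun d _ => Polynomial.cyclotomic.monic d ℤ
    have hdeg : D.natDegree = n s + (E s).natDegree := by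
      rw [hDE s, ← Polynomial.C_1,
        (Polynomial.monic_X_pow_sub_C (1 : ℤ) (hn s).ne').natDegree_mul hEmonic,
        Polynomial.natDegree_X_pow_sub_C]
    refine Polynomial.degree_le_natDegree.trans_lt (Nat.cast_lt.2 ?_)
    have h1 : (Polynomial.C (lam s) * Polynomial.X ^ a s * E s).natDegree ≤
        a s + (E s).natDegree :=
      Polynomial.natDegree_mul_le_of_le (Polynomial.natDegree_C_mul_X_pow_le _ _) le_rfl
    have h2 := ha s
    omega
  constructor
  · intro h
    rw [h, map_zero] at hPζ
    exact (mul_eq_zero.1 hPζ.symm).resolve_left (neg_ne_zero.2 hDζ)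
  · intro h
    exact hζ.eq_zero_of_degree_lt_of_aeval_eq_zero hp.pos hPdeg (by rw [hPζ, h, mul_zero])
end

section
/- Let 𝒜 = {⟨λ_s, a_s, n_s⟩}_{s=1}^k where λ_s, a_s, n_s are integers with n_s ≥ 1 and 0 ≤ a_s < n_s, and let N be a positive common multiple of n_1,...,n_k. Then for every complex number z, Σ_{r=0}^{N−1} w_𝒜(r) z^r = N · Σ_{1 ≤ s ≤ k, z^{n_s} = 1} (λ_s/n_s) z^{a_s} + (1 − z^N) · Σ_{1 ≤ s ≤ k, z^{n_s} ≠ 1} λ_s z^{a_s}/(1 − z^{n_s}). -/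
open Finset
open scoped Classical

/-- A sum over the elements of `range (n * m)` congruent to `a` modulo `n`. -/
lemma sum_range_mul_filter_dvd_sub {M : Type*} [AddCommMonoid M] (f : ℕ → M) {a n : ℕ}
    (ha : a < n) (m : ℕ) :
    ∑ r ∈ (range (n * m)).filter (fun r : ℕ => (n : ℤ) ∣ (r : ℤ) - (a : ℤ)), f r =
      ∑ j ∈ range m, f (a + n * j) := by
  have hn : 0 < n := by lia
  symm
  refine sum_nbij' (fun j => a + n * j) (fun r => r / n) ?_ ?_ ?_ ?_ (fun _ _ => rfl)
  · intro j hj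
    simp only [mem_range, mem_filter] at hj ⊢
    refine ⟨?_, j, by push_cast; ring⟩
    calc a + n * j < n + n * j := by lia
      _ = n * (j + 1) := by ring
      _ ≤ n * m := Nat.mul_le_mul_left n hj
  · intro r hr
    simp only [mem_range, mem_filter] at hr ⊢
    exact Nat.div_lt_of_lt_mul hr.1
  · intro j _
    simp [Nat.add_mul_div_left _ _ hn, Nat.div_eq_of_lt ha]
  · intro r hr
    simp only [mem_range, mem_filter] at hr
    have h : a % n = r % n := (Nat.modEq_iff_dvd).2 hr.2
    rw [Nat.mod_eq_of_lt ha] at h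
    simp only [h, Nat.mod_add_div]

/-- The generating polynomial of a residue class over a period. -/
lemma sum_range_mul_pow_filter_dvd_sub {K : Type*} [Field K] [CharZero K] (z : K) {a n : ℕ}
    (ha : a < n) (m : ℕ) :
    ∑ r ∈ (range (n * m)).filter (fun r : ℕ => (n : ℤ) ∣ (r : ℤ) - (a : ℤ)), z ^ r =
      if z ^ n = 1 then ((n * m : ℕ) : K) * (z ^ a / n)
      else (1 - z ^ (n * m)) * (z ^ a / (1 - z ^ n)) := by
  rw [sum_range_mul_filter_dvd_sub _ ha]
  simp only [pow_add, pow_mul z n, ← mul_sum]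
  split_ifs with h
  · have hn : (n : K) ≠ 0 := by exact_mod_cast (by lia : n ≠ 0)
    simp only [h, one_pow, sum_const, card_range, nsmul_eq_mul, mul_one]
    push_cast
    field_simp
  · have h1 : 1 - z ^ n ≠ 0 := sub_ne_zero.2 (Ne.symm h)
    rw [mul_div_assoc', eq_div_iff h1]
    linear_combination z ^ a * mul_neg_geom_sum (z ^ n) m

/-- The key identity in the proof of Theorem 1.2: for
`𝒜 = {⟨λ_s, a_s, n_s⟩}_{s=1}^k` (with `n_s ≥ 1`, `0 ≤ a_s < n_s`) and a
positive common multiple `N` of the moduli, for every `z ∈ ℂ`,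
`∑_{r=0}^{N−1} w_𝒜(r) z^r
  = N ∑_{z^{n_s} = 1} (λ_s/n_s) z^{a_s}
    + (1 − z^N) ∑_{z^{n_s} ≠ 1} λ_s z^{a_s}/(1 − z^{n_s})`. -/
theorem sum_w_mul_pow_eq
    {k : ℕ} (lam : Fin k → ℤ) (a n : Fin k → ℕ)
    (hn : ∀ s, 0 < n s) (ha : ∀ s, a s < n s)
    (N : ℕ) (hN : 0 < N) (hdvd : ∀ s, n s ∣ N) :
    ∀ z : ℂ,
      ∑ r ∈ range N,
          ((∑ s ∈ (univ : Finset (Fin k)).filter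
              (fun s => (n s : ℤ) ∣ (r : ℤ) - (a s : ℤ)), lam s : ℤ) : ℂ) * z ^ r =
        (N : ℂ) * ∑ s ∈ (univ : Finset (Fin k)).filter (fun s => z ^ (n s) = 1),
            ((lam s : ℂ) / (n s : ℂ)) * z ^ (a s) +
          (1 - z ^ N) * ∑ s ∈ (univ : Finset (Fin k)).filter (fun s => z ^ (n s) ≠ 1),
            (lam s : ℂ) * z ^ (a s) / (1 - z ^ (n s)) := by
  intro z
  simp only [Int.cast_sum, Int.cast_ite, Int.cast_zero, sum_mul, mul_sum, sum_filter]
  rw [sum_comm, ← sum_add_distrib]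
  refine sum_congr rfl fun s _ => ?_
  obtain ⟨m, rfl⟩ := hdvd s
  have h := congrArg ((lam s : ℂ) * ·) (sum_range_mul_pow_filter_dvd_sub z (ha s) m)
  simp only [mul_sum, sum_filter] at h
  simp only [ite_mul, zero_mul, mul_ite, mul_zero] at h ⊢
  rw [h]
  by_cases hz : z ^ n s = 1
  · simp only [hz, if_true, ne_eq, not_true, if_false, add_zero]
    ring
  · simp only [hz, if_false, ne_eq, not_false_eq_true, if_true, zero_add]
    ring
end

section
/- Let 𝒜 = {⟨λ_s, a_s, n_s⟩}_{s=1}^k where λ_s, a_s, n_s are integers with n_s ≥ 1 and 0 ≤ a_s < n_s. Let p be a prime with p > |S(n_1,...,n_k)|, let ζ_p be a primitive p-th root of unity, and suppose Σ_{s=1}^k λ_s ζ_p^{a_s}/(1 − ζ_p^{n_s}) = 0. Then Σ_{1 ≤ s ≤ k, α n_s ∈ ℤ} (λ_s/n_s) e^{2πiα a_s} = 0 for every nonzero α ∈ S(n_1,...,n_k), and also Σ_{s=1}^k λ_s/n_s = 0. -/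
open Finset Complex
open scoped Classical Real

open Polynomial in
/-- The cofactor of `X ^ m - 1` in the product of the cyclotomic polynomials indexed by `T`. -/
noncomputable def cyclotomicCofactor (T : Finset ℕ) (m : ℕ) : ℚ[X] :=
  ∏ d ∈ T \ m.divisors, cyclotomic d ℚ

open Polynomial in
theorem X_pow_sub_one_mul_cyclotomicCofactor {T : Finset ℕ} {m : ℕ} (hm : 0 < m)
    (hT : m.divisors ⊆ T) :
    (X ^ m - 1) * cyclotomicCofactor T m = ∏ d ∈ T, cyclotomic d ℚ := by
  rw [← prod_cyclotomic_eq_X_pow_sub_one hm, cyclotomicCofactor, mul_comm,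
    Finset.prod_sdiff hT]

open Polynomial in
theorem aeval_cyclotomicCofactor_ne_zero (T : Finset ℕ) {m : ℕ} (hm : 0 < m)
    (hT : ∀ d ∈ T, 0 < d) {z : ℂ} (hz : z ^ m = 1) :
    aeval z (cyclotomicCofactor T m) ≠ 0 := by
  rw [cyclotomicCofactor, map_prod, Finset.prod_ne_zero_iff]
  intro d hd h
  rw [Finset.mem_sdiff, Nat.mem_divisors] at hd
  have : NeZero (d : ℂ) := ⟨by exact_mod_cast (hT d hd.1).ne'⟩
  rw [aeval_def, ← eval_map, map_cyclotomic] at h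
  exact hd.2 ⟨(isRoot_cyclotomic_iff.mp h).dvd_of_pow_eq_one m hz, hm.ne'⟩

open Polynomial in
theorem natDegree_prod_cyclotomic (T : Finset ℕ) :
    (∏ d ∈ T, cyclotomic d ℚ).natDegree = ∑ d ∈ T, d.totient := by
  rw [natDegree_prod_of_monic _ _ fun d _ => cyclotomic.monic d ℚ]
  simp only [natDegree_cyclotomic]

/-- A set of rationals containing all fractions `r / n s` in `[0, 1)` has at least as many elements
as the totients of the divisors of the `n s` add up to. -/
theorem sum_totient_le_card_of_div_mem {ι : Type*} [Fintype ι] (n : ι → ℕ)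
    (hn : ∀ s, 0 < n s) {S : Finset ℚ} (hS : ∀ s, ∀ r < n s, (r : ℚ) / (n s : ℚ) ∈ S) :
    ∑ d ∈ (univ : Finset ι).biUnion (fun s => (n s).divisors), d.totient ≤ S.card := by
  set T := (univ : Finset ι).biUnion (fun s => (n s).divisors) with hT
  calc ∑ d ∈ T, d.totient ≤ ∑ d ∈ T, (S.filter fun x => x.den = d).card := by
        refine Finset.sum_le_sum fun d hd => ?_
        simp only [hT, Finset.mem_biUnion, Finset.mem_univ, true_and, Nat.mem_divisors] at hd
        obtain ⟨s, hds, -⟩ := hd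
        obtain ⟨e, he⟩ := hds
        have hd0 : 0 < d := Nat.pos_of_ne_zero fun h => (hn s).ne' (by simp [he, h])
        have he0 : 0 < e := Nat.pos_of_ne_zero fun h => (hn s).ne' (by simp [he, h])
        rw [Nat.totient]
        refine Finset.card_le_card_of_injOn (fun r : ℕ => (r : ℚ) / d) ?_ ?_
        · intro r hr
          obtain ⟨hrd, hcop⟩ := Finset.mem_filter.mp (Finset.mem_coe.mp hr)
          rw [Finset.mem_range] at hrd
          refine Finset.mem_coe.mpr (Finset.mem_filter.mpr ⟨?_, ?_⟩)
          · have he' : (e : ℚ) ≠ 0 := by exact_mod_cast he0.ne'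
            have h := hS s (r * e) (by rw [he]; exact Nat.mul_lt_mul_of_pos_right hrd he0)
            rw [he] at h
            push_cast at h
            rwa [mul_div_mul_right _ _ he'] at h
          · have h := Rat.den_div_eq_of_coprime (a := (r : ℤ)) (b := (d : ℤ))
              (by exact_mod_cast hd0) (by simpa using hcop.symm)
            rw [Int.cast_natCast, Int.cast_natCast] at h
            exact Int.ofNat_inj.mp h
        · intro x _ y _ hxy
          have : (d : ℚ) ≠ 0 := by exact_mod_cast hd0.ne'
          exact_mod_cast (div_left_inj' this).mp hxy
    _ ≤ S.card := by
        rw [← Finset.card_biUnion]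
        · exact Finset.card_le_card (Finset.biUnion_subset.mpr fun d _ => Finset.filter_subset _ _)
        · intro x _ y _ hxy
          exact Finset.disjoint_filter.mpr fun q _ h1 h2 => hxy (h1.symm.trans h2)

open Polynomial in
/-- The numerator of `∑ s, lam s * X ^ a s / (X ^ n s - 1)` over a common denominator vanishes. -/
theorem sum_mul_cyclotomicCofactor_eq_zero {ι : Type*} [Fintype ι] (lam : ι → ℤ) (a n : ι → ℕ)
    (hn : ∀ s, 0 < n s) (ha : ∀ s, a s < n s) {p : ℕ} (hp : p.Prime) {T : Finset ℕ}
    (hT : ∀ s, (n s).divisors ⊆ T) (hTp : ∑ d ∈ T, d.totient < p)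
    {ζ : ℂ} (hζ : IsPrimitiveRoot ζ p)
    (hsum : ∑ s, (lam s : ℂ) * ζ ^ (a s) / (1 - ζ ^ (n s)) = 0) :
    ∑ s, C (lam s : ℚ) * X ^ a s * cyclotomicCofactor T (n s) = 0 := by
  set D : ℚ[X] := ∏ d ∈ T, cyclotomic d ℚ with hD
  have hmul (s) := X_pow_sub_one_mul_cyclotomicCofactor (hn s) (hT s)
  have hD0 : D ≠ 0 := Finset.prod_ne_zero_iff.mpr fun d _ => cyclotomic_ne_zero d ℚ
  have hQ0 (s) : cyclotomicCofactor T (n s) ≠ 0 :=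
    Finset.prod_ne_zero_iff.mpr fun d _ => cyclotomic_ne_zero d ℚ
  have hdegD (s) : D.natDegree = n s + (cyclotomicCofactor T (n s)).natDegree := by
    rw [hD, ← hmul s, ← C_1, natDegree_mul (X_pow_sub_C_ne_zero (hn s) 1) (hQ0 s),
      natDegree_X_pow_sub_C]
  have hnp (s) : n s < p := by
    have := hdegD s
    rw [natDegree_prod_cyclotomic] at this
    omega
  have hζn (s) : 1 - ζ ^ n s ≠ 0 := fun h =>
    hζ.pow_ne_one_of_pos_of_lt (hn s).ne' (hnp s) (sub_eq_zero.mp h).symm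
  set P := ∑ s, C (lam s : ℚ) * X ^ a s * cyclotomicCofactor T (n s) with hP
  have hroot : aeval ζ P = 0 := by
    have hterm (s) : aeval ζ (C (lam s : ℚ) * X ^ a s * cyclotomicCofactor T (n s)) =
        -aeval ζ D * ((lam s : ℂ) * ζ ^ (a s) / (1 - ζ ^ (n s))) := by
      have h := congrArg (aeval ζ) (hmul s)
      simp only [map_mul, map_sub, map_pow, aeval_X, map_one] at h
      rw [hD, ← h]
      simp only [map_mul, map_pow, aeval_X, aeval_C]
      have := hζn s
      field_simp
      simp
      ring
    rw [hP, map_sum, Finset.sum_congr rfl fun s _ => hterm s, ← Finset.mul_sum, hsum, mul_zero]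
  have hdegP : P.degree < D.degree := by
    rw [hP]
    refine (degree_sum_le _ _).trans_lt ((Finset.sup_lt_iff ?_).mpr fun s _ => ?_)
    · exact bot_lt_iff_ne_bot.mpr (degree_ne_bot.mpr hD0)
    · rw [degree_eq_natDegree hD0, hdegD s, degree_mul, degree_eq_natDegree (hQ0 s), Nat.cast_add]
      refine WithBot.add_lt_add_right (WithBot.natCast_ne_bot _) ?_
      exact (degree_C_mul_X_pow_le _ _).trans_lt (by exact_mod_cast ha s)
  have hdvd : cyclotomic p ℚ ∣ P := by
    rw [cyclotomic_eq_minpoly_rat hζ hp.pos]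
    exact minpoly.dvd ℚ ζ hroot
  refine eq_zero_of_dvd_of_degree_lt hdvd (hdegP.trans_le ?_)
  rw [degree_cyclotomic, degree_eq_natDegree hD0, natDegree_prod_cyclotomic,
    Nat.totient_prime hp]
  exact_mod_cast Nat.le_sub_one_of_lt hTp

open Polynomial in
/-- Comparing residues at `z` in an identity of partial fractions. -/
theorem sum_div_mul_pow_eq_zero {ι : Type*} [Fintype ι] (lam : ι → ℤ) (a n : ι → ℕ)
    (hn : ∀ s, 0 < n s) {T : Finset ℕ} (hT0 : ∀ d ∈ T, 0 < d)
    (hT : ∀ s, (n s).divisors ⊆ T)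
    (hP : ∑ s, C (lam s : ℚ) * X ^ a s * cyclotomicCofactor T (n s) = 0) (z : ℂ) :
    ∑ s ∈ univ.filter (fun s => z ^ n s = 1), (lam s : ℂ) / (n s : ℂ) * z ^ a s = 0 := by
  set D : ℚ[X] := ∏ d ∈ T, cyclotomic d ℚ with hD
  have hmul (s) : (X ^ n s - 1) * cyclotomicCofactor T (n s) = D :=
    X_pow_sub_one_mul_cyclotomicCofactor (hn s) (hT s)
  by_cases hF : ∃ s, z ^ n s = 1
  swap
  · rw [Finset.filter_false_of_mem fun s _ h => hF ⟨s, h⟩, Finset.sum_empty]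
  obtain ⟨t, ht⟩ := hF
  have hz0 : z ≠ 0 := fun h => by simp [h, (hn t).ne'] at ht
  have hev (s) : (z ^ n s - 1) * aeval z (cyclotomicCofactor T (n s)) = aeval z D := by
    simpa using congrArg (aeval z) (hmul s)
  have hDz : aeval z D = 0 := by rw [← hev t, ht, sub_self, zero_mul]
  have hder (s) (hs : z ^ n s = 1) :
      z * aeval z (derivative D) = n s * aeval z (cyclotomicCofactor T (n s)) := by
    have h : z * (n s * z ^ (n s - 1)) = n s := by
      rw [mul_left_comm, mul_pow_sub_one (hn s).ne', hs, mul_one]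
    rw [← hmul s]
    simp only [derivative_mul, map_sub, derivative_X_pow, derivative_one, map_add, map_mul,
      map_pow, aeval_X, map_one, map_natCast, map_zero, hs]
    linear_combination (aeval z (cyclotomicCofactor T (n s))) * h
  have hc : z * aeval z (derivative D) ≠ 0 := by
    rw [hder t ht]
    exact mul_ne_zero (by exact_mod_cast (hn t).ne')
      (aeval_cyclotomicCofactor_ne_zero T (hn t) hT0 ht)
  refine (mul_eq_zero.mp ?_).resolve_left hc
  have h := congrArg (aeval z) hP
  rw [map_sum, map_zero] at h
  rw [← h, Finset.mul_sum, Finset.sum_filter]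
  refine Finset.sum_congr rfl fun s _ => ?_
  have hns : (n s : ℂ) ≠ 0 := by exact_mod_cast (hn s).ne'
  simp only [map_mul, map_pow, aeval_X, aeval_C, eq_ratCast, Rat.cast_intCast]
  split_ifs with hs
  · rw [hder s hs]
    field_simp
  · have := hev s
    rw [hDz, mul_eq_zero, sub_eq_zero] at this
    rw [this.resolve_left hs, mul_zero]

theorem exp_two_pi_mul_I_pow_eq_one_iff (α : ℚ) (m : ℕ) :
    Complex.exp (2 * π * I * (α : ℂ)) ^ m = 1 ↔ (α * (m : ℚ)).den = 1 := by
  rw [← Complex.exp_nat_mul, Complex.exp_eq_one_iff, Rat.den_eq_one_iff]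
  have hpi : (2 * π * I : ℂ) ≠ 0 := Complex.two_pi_I_ne_zero
  constructor
  · rintro ⟨j, hj⟩
    have : ((α * m : ℚ) : ℂ) = ((j : ℚ) : ℂ) := by
      push_cast
      exact mul_left_cancel₀ hpi (by linear_combination hj)
    rw [Rat.cast_injective this, Rat.num_intCast]
  · intro h
    refine ⟨(α * (m : ℚ)).num, ?_⟩
    have h' : (((α * (m : ℚ)).num : ℚ) : ℂ) = ((α * m : ℚ) : ℂ) := congrArg _ h
    push_cast at h'
    linear_combination (-(2 * π * I : ℂ)) * h'

/-- The key step in the proof of Theorem 1.2: for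
`𝒜 = {⟨λ_s, a_s, n_s⟩}_{s=1}^k` (with `n_s ≥ 1`, `0 ≤ a_s < n_s`), a prime
`p > |S(n_1,…,n_k)|` and a primitive `p`-th root of unity `ζ`, if
`∑_s λ_s ζ^{a_s}/(1 − ζ^{n_s}) = 0` then
`∑_{α n_s ∈ ℤ} (λ_s/n_s) e^{2πiα a_s} = 0` for every nonzero
`α ∈ S(n_1,…,n_k)`, and also `∑_s λ_s/n_s = 0`. -/
theorem fourier_coeffs_vanish
    {k : ℕ} (lam : Fin k → ℤ) (a n : Fin k → ℕ)
    (hn : ∀ s, 0 < n s) (ha : ∀ s, a s < n s)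
    (p : ℕ) (hp : p.Prime)
    (hpS : (((univ : Finset (Fin k)).biUnion fun s =>
               (range (n s)).image fun r => (r : ℚ) / (n s : ℚ))).card < p)
    (ζ : ℂ) (hζ : IsPrimitiveRoot ζ p)
    (hsum : ∑ s, (lam s : ℂ) * ζ ^ (a s) / (1 - ζ ^ (n s)) = 0) :
    (∀ α ∈ ((univ : Finset (Fin k)).biUnion fun s =>
        (range (n s)).image fun r => (r : ℚ) / (n s : ℚ)), α ≠ 0 →
      ∑ s ∈ (univ : Finset (Fin k)).filter (fun s => (α * (n s : ℚ)).den = 1),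
          ((lam s : ℂ) / (n s : ℂ)) * Complex.exp (2 * π * I * (α : ℂ) * (a s : ℂ)) = 0) ∧
    ∑ s, (lam s : ℚ) / (n s : ℚ) = 0 := by
  set T := (univ : Finset (Fin k)).biUnion (fun s => (n s).divisors)
  have hT (s) : (n s).divisors ⊆ T :=
    Finset.subset_biUnion_of_mem (fun s => (n s).divisors) (Finset.mem_univ s)
  have hT0 (d) (hd : d ∈ T) : 0 < d := by
    obtain ⟨s, -, hs⟩ := Finset.mem_biUnion.mp hd
    exact Nat.pos_of_mem_divisors hs
  have hS (s) (r : ℕ) (hr : r < n s) : (r : ℚ) / (n s : ℚ) ∈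
      ((univ : Finset (Fin k)).biUnion fun s =>
        (range (n s)).image fun r => (r : ℚ) / (n s : ℚ)) := by
    simpa using ⟨s, r, hr, rfl⟩
  have hres := sum_div_mul_pow_eq_zero lam a n hn hT0 hT
    (sum_mul_cyclotomicCofactor_eq_zero lam a n hn ha hp hT
      ((sum_totient_le_card_of_div_mem n hn hS).trans_lt hpS) hζ hsum)
  constructor
  · intro α _ _
    rw [← hres (Complex.exp (2 * π * I * (α : ℂ)))]
    simp only [exp_two_pi_mul_I_pow_eq_one_iff]
    refine Finset.sum_congr rfl fun s _ => ?_
    rw [← Complex.exp_nat_mul, mul_comm (a s : ℂ)]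
  · have h := hres 1
    simp only [one_pow, Finset.filter_true, mul_one] at h
    exact_mod_cast h
end

section
/- Let 𝒜 = {⟨λ_s, a_s, n_s⟩}_{s=1}^k where λ_s, a_s, n_s are integers with n_s ≥ 1 and 0 ≤ a_s < n_s. Then the weighted covering function w_𝒜 is constant on ℤ if and only if Σ_{1 ≤ s ≤ k, α n_s ∈ ℤ} (λ_s/n_s) e^{2πiα a_s} = 0 for every nonzero α ∈ S(n_1,...,n_k); and in that case the constant value of w_𝒜 equals Σ_{s=1}^k λ_s/n_s. -/
open Finset Complex
open scoped Classical Real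

/-- The additive character `q ↦ e^{2πiq}` of `ℚ`. -/
noncomputable def ratChar (q : ℚ) : ℂ := Complex.exp (2 * π * I * (q : ℂ))

lemma ratChar_add (p q : ℚ) : ratChar (p + q) = ratChar p * ratChar q := by
  simp only [ratChar, ← Complex.exp_add]
  push_cast
  ring_nf

lemma ratChar_eq_one_iff (q : ℚ) : ratChar q = 1 ↔ ∃ z : ℤ, q = z := by
  rw [ratChar, Complex.exp_eq_one_iff]
  refine exists_congr fun z => ?_
  rw [mul_comm (z : ℂ), mul_right_inj' Complex.two_pi_I_ne_zero]
  exact_mod_cast Iff.rfl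

lemma ratChar_mul_natCast (q : ℚ) (m : ℕ) : ratChar (q * m) = ratChar q ^ m := by
  rw [ratChar, ratChar, ← Complex.exp_nat_mul]
  push_cast
  ring_nf

/-- Orthogonality of characters of `ℤ/m`. -/
lemma sum_ratChar_mul (q : ℚ) (m : ℕ) (h : ∃ z : ℤ, q * m = z) :
    ∑ r ∈ range m, ratChar (q * r) = if ∃ z : ℤ, q = z then (m : ℂ) else 0 := by
  simp only [ratChar_mul_natCast]
  split_ifs with hq
  · simp [(ratChar_eq_one_iff q).2 hq]
  · have hq1 : ratChar q ≠ 1 := fun hc => hq ((ratChar_eq_one_iff q).1 hc)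
    rw [geom_sum_eq hq1, ← ratChar_mul_natCast, (ratChar_eq_one_iff _).2 h]
    simp

lemma sum_range_ratChar_div (m : ℕ) (hm : 0 < m) (y : ℤ) :
    ∑ r ∈ range m, ratChar ((r : ℚ) / m * y) = if (m : ℤ) ∣ y then (m : ℂ) else 0 := by
  have hm' : (m : ℚ) ≠ 0 := by positivity
  have h := sum_ratChar_mul ((y : ℚ) / m) m ⟨y, by field_simp⟩
  have hiff : (∃ z : ℤ, (y : ℚ) / m = z) ↔ (m : ℤ) ∣ y := by
    refine exists_congr fun z => ?_
    rw [div_eq_iff hm', mul_comm]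
    exact_mod_cast Iff.rfl
  simp only [hiff] at h
  rw [← h]
  refine sum_congr rfl fun r _ => ?_
  congr 1
  ring

section CoveringSystem

variable {k : ℕ} (lam : Fin k → ℤ) (a n : Fin k → ℕ)

/-- The set `S(n_1, …, n_k)` of fractions `r / n_s` with `0 ≤ r < n_s`. -/
noncomputable def fractionSet : Finset ℚ :=
  (univ : Finset (Fin k)).biUnion fun s => (range (n s)).image fun r : ℕ => (r : ℚ) / (n s : ℚ)

/-- The weighted covering function of the system. -/
noncomputable def coveringFun (x : ℤ) : ℤ :=
  ∑ s ∈ (univ : Finset (Fin k)).filter (fun s => (n s : ℤ) ∣ x - (a s : ℤ)), lam s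

/-- The Fourier coefficient of the weighted covering function at the frequency `-α`. -/
noncomputable def coveringCoeff (α : ℚ) : ℂ :=
  ∑ s ∈ (univ : Finset (Fin k)).filter (fun s => (α * (n s : ℚ)).den = 1),
    ((lam s : ℂ) / (n s : ℂ)) * Complex.exp (2 * π * I * (α : ℂ) * (a s : ℂ))

variable {n}

lemma mem_fractionSet {α : ℚ} :
    α ∈ fractionSet n ↔ ∃ s, ∃ r < n s, (r : ℚ) / (n s : ℚ) = α := by
  simp [fractionSet]

lemma fractionSet_nonneg_lt_one {α : ℚ} (hα : α ∈ fractionSet n) : 0 ≤ α ∧ α < 1 := by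
  obtain ⟨s, r, hr, rfl⟩ := mem_fractionSet.1 hα
  have : (r : ℚ) < n s := by exact_mod_cast hr
  have h0 : (0 : ℚ) ≤ r := by positivity
  exact ⟨by positivity, (div_lt_one (by linarith)).2 this⟩

lemma fractionSet_mul_prod {α : ℚ} (hα : α ∈ fractionSet n) :
    ∃ z : ℤ, α * ((∏ s, n s : ℕ) : ℚ) = z := by
  obtain ⟨s, r, hr, rfl⟩ := mem_fractionSet.1 hα
  obtain ⟨c, hc⟩ := dvd_prod_of_mem n (mem_univ s)
  have : (n s : ℚ) ≠ 0 := by exact_mod_cast (by omega : n s ≠ 0)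
  refine ⟨r * c, ?_⟩
  rw [hc]
  push_cast
  field_simp

lemma fractionSet_filter (hn : ∀ s, 0 < n s) (s : Fin k) :
    (fractionSet n).filter (fun α => (α * (n s : ℚ)).den = 1) =
      (range (n s)).image fun r : ℕ => (r : ℚ) / (n s : ℚ) := by
  have hs : (0 : ℚ) < n s := by exact_mod_cast hn s
  ext α
  simp only [mem_filter, mem_image, mem_range]
  constructor
  · rintro ⟨hα, hden⟩
    obtain ⟨h0, h1⟩ := fractionSet_nonneg_lt_one hα
    have hz : (((α * n s).num : ℤ) : ℚ) = α * n s := (Rat.den_eq_one_iff _).1 hden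
    have hnum : 0 ≤ (α * n s).num := Rat.num_nonneg.2 (by positivity)
    obtain ⟨r, hr⟩ := Int.eq_ofNat_of_zero_le hnum
    rw [hr, Int.cast_natCast] at hz
    refine ⟨r, ?_, by rw [hz]; field_simp⟩
    have : (r : ℚ) < n s := by rw [hz]; nlinarith
    exact_mod_cast this
  · rintro ⟨r, hr, rfl⟩
    refine ⟨mem_fractionSet.2 ⟨s, r, hr, rfl⟩, ?_⟩
    rw [div_mul_cancel₀ _ hs.ne']
    simp

/-- The finite Fourier expansion of the weighted covering function. -/
lemma coveringFun_eq_sum (hn : ∀ s, 0 < n s) (x : ℤ) :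
    (coveringFun lam a n x : ℂ) =
      ∑ α ∈ fractionSet n, coveringCoeff lam a n α * ratChar (-α * x) := by
  have key : ∀ s, ∑ α ∈ (fractionSet n).filter (fun α => (α * (n s : ℚ)).den = 1),
      (lam s : ℂ) / (n s : ℂ) * ratChar (α * ((a s - x : ℤ) : ℚ)) =
        if (n s : ℤ) ∣ x - a s then (lam s : ℂ) else 0 := by
    intro s
    have hs : (n s : ℂ) ≠ 0 := by exact_mod_cast (hn s).ne'
    have hs' : (n s : ℚ) ≠ 0 := by exact_mod_cast (hn s).ne'
    rw [fractionSet_filter hn, sum_image, ← mul_sum, sum_range_ratChar_div _ (hn s)]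
    · simp only [dvd_sub_comm (b := (a s : ℤ)), mul_ite, mul_zero, div_mul_cancel₀ _ hs]
    · intro r _ t _ h
      have h' : (r : ℚ) / n s = t / n s := h
      rw [div_left_inj' hs'] at h'
      exact_mod_cast h'
  simp only [coveringFun, coveringCoeff]
  push_cast
  rw [sum_filter, ← sum_congr rfl fun s _ => key s]
  simp only [sum_mul, sum_filter]
  rw [sum_comm]
  refine sum_congr rfl fun α _ => sum_congr rfl fun s _ => ?_
  split_ifs
  · have : α * ((a s - x : ℤ) : ℚ) = α * a s + -α * x := by push_cast; ring
    rw [this, ratChar_add, ← mul_assoc]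
    simp [ratChar, mul_assoc]
  · rw [zero_mul]

/-- Fourier inversion for the weighted covering function. -/
lemma sum_coveringFun_mul_ratChar (hn : ∀ s, 0 < n s) {α : ℚ} (hα : α ∈ fractionSet n) :
    ∑ x ∈ range (∏ s, n s), (coveringFun lam a n x : ℂ) * ratChar (α * x) =
      coveringCoeff lam a n α * (∏ s, n s : ℕ) := by
  simp only [coveringFun_eq_sum lam a hn, sum_mul]
  rw [sum_comm, sum_eq_single_of_mem α hα]
  · simp only [mul_assoc, ← ratChar_add, ← mul_sum]
    simp [ratChar]
  · intro β hβ hne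
    have hsum := sum_ratChar_mul (α - β) (∏ s, n s) (by
      obtain ⟨z, hz⟩ := fractionSet_mul_prod hα
      obtain ⟨w, hw⟩ := fractionSet_mul_prod hβ
      exact ⟨z - w, by rw [sub_mul, hz, hw]; push_cast; rfl⟩)
    rw [if_neg] at hsum
    · rw [← mul_zero (coveringCoeff lam a n β), ← hsum, mul_sum]
      refine sum_congr rfl fun x _ => ?_
      rw [mul_assoc, ← ratChar_add]
      congr 2
      push_cast
      ring
    · rintro ⟨z, hz⟩
      obtain ⟨h1, h2⟩ := fractionSet_nonneg_lt_one hα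
      obtain ⟨h3, h4⟩ := fractionSet_nonneg_lt_one hβ
      have hz1 : (z : ℚ) < 1 := by linarith
      have hz2 : (-1 : ℚ) < z := by linarith
      have hz1' : z < 1 := by exact_mod_cast hz1
      have hz2' : -1 < z := by exact_mod_cast hz2
      obtain rfl : z = 0 := by omega
      exact hne (by push_cast at hz; linarith)

lemma coveringCoeff_eq_zero_of_const (hn : ∀ s, 0 < n s) {c : ℤ}
    (hc : ∀ x, coveringFun lam a n x = c) {α : ℚ} (hα : α ∈ fractionSet n) (h0 : α ≠ 0) :
    coveringCoeff lam a n α = 0 := by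
  have h := sum_coveringFun_mul_ratChar lam a hn hα
  simp only [hc] at h
  rw [← mul_sum, sum_ratChar_mul α _ (fractionSet_mul_prod hα), if_neg, mul_zero] at h
  · have hN : ((∏ s, n s : ℕ) : ℂ) ≠ 0 := by
      exact_mod_cast (prod_pos fun s _ => hn s).ne'
    exact (mul_eq_zero.1 h.symm).resolve_right hN
  · rintro ⟨z, hz⟩
    obtain ⟨h1, h2⟩ := fractionSet_nonneg_lt_one hα
    rw [hz] at h1 h2
    have h1' : 0 ≤ z := by exact_mod_cast h1
    have h2' : z < 1 := by exact_mod_cast h2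
    obtain rfl : z = 0 := by omega
    exact h0 (by simpa using hz)

lemma coveringFun_eq_of_coeff_eq_zero (hn : ∀ s, 0 < n s)
    (h : ∀ α ∈ fractionSet n, α ≠ 0 → coveringCoeff lam a n α = 0) (x : ℤ) :
    (coveringFun lam a n x : ℚ) = ∑ s, (lam s : ℚ) / (n s : ℚ) := by
  have hC : (coveringFun lam a n x : ℂ) = ∑ s, (lam s : ℂ) / (n s : ℂ) := by
    rw [coveringFun_eq_sum lam a hn, sum_eq_single 0]
    · simp [coveringCoeff, ratChar]
    · intro α hα h0
      rw [h α hα h0, zero_mul]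
    · intro h0
      have : IsEmpty (Fin k) := ⟨fun s => h0 (mem_fractionSet.2 ⟨s, 0, hn s, by simp⟩)⟩
      simp [coveringCoeff]
  exact_mod_cast hC

end CoveringSystem

/-- For `𝒜 = {⟨λ_s, a_s, n_s⟩}_{s=1}^k` (with `n_s ≥ 1`, `0 ≤ a_s < n_s`), the
weighted covering function `w_𝒜` is constant on `ℤ` iff
`∑_{α n_s ∈ ℤ} (λ_s/n_s) e^{2πiα a_s} = 0` for every nonzero
`α ∈ S(n_1,…,n_k)`; and in that case its constant value equals
`∑_s λ_s/n_s`. -/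
theorem w_constant_iff
    {k : ℕ} (lam : Fin k → ℤ) (a n : Fin k → ℕ)
    (hn : ∀ s, 0 < n s) (ha : ∀ s, a s < n s) :
    ((∃ c : ℤ, ∀ x : ℤ, ∑ s ∈ (univ : Finset (Fin k)).filter
          (fun s => (n s : ℤ) ∣ x - (a s : ℤ)), lam s = c) ↔
      (∀ α ∈ ((univ : Finset (Fin k)).biUnion fun s =>
          (range (n s)).image fun r => (r : ℚ) / (n s : ℚ)), α ≠ 0 →
        ∑ s ∈ (univ : Finset (Fin k)).filter (fun s => (α * (n s : ℚ)).den = 1),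
            ((lam s : ℂ) / (n s : ℂ)) * Complex.exp (2 * π * I * (α : ℂ) * (a s : ℂ)) = 0)) ∧
    ((∀ α ∈ ((univ : Finset (Fin k)).biUnion fun s =>
          (range (n s)).image fun r => (r : ℚ) / (n s : ℚ)), α ≠ 0 →
        ∑ s ∈ (univ : Finset (Fin k)).filter (fun s => (α * (n s : ℚ)).den = 1),
            ((lam s : ℂ) / (n s : ℂ)) * Complex.exp (2 * π * I * (α : ℂ) * (a s : ℂ)) = 0) →
      ∀ x : ℤ, ((∑ s ∈ (univ : Finset (Fin k)).filter
          (fun s => (n s : ℤ) ∣ x - (a s : ℤ)), lam s : ℤ) : ℚ) =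
        ∑ s, (lam s : ℚ) / (n s : ℚ)) := by
  have hS : ((univ : Finset (Fin k)).biUnion fun s =>
      (range (n s)).image fun r => (r : ℚ) / (n s : ℚ)) = fractionSet n := by
    ext α
    simp [fractionSet]
  rw [hS]
  have hval := coveringFun_eq_of_coeff_eq_zero lam a hn
  refine ⟨⟨?_, fun h => ⟨coveringFun lam a n 0, fun x => ?_⟩⟩, hval⟩
  · rintro ⟨c, hc⟩ α hα h0
    exact coveringCoeff_eq_zero_of_const lam a hn hc hα h0
  · exact_mod_cast (hval h x).trans (hval h 0).symm
end

section
/- Let 𝒜 = {⟨λ_s, a_s, n_s⟩}_{s=1}^k where λ_s, a_s, n_s are integers with n_s ≥ 1 and 0 ≤ a_s < n_s. Let p be a prime with p > max{n_1,...,n_k}, let ζ_p be a primitive p-th root of unity, let N be a positive common multiple of n_1,...,n_k with N ≡ 1 (mod p), and for l = 0,...,p−1 set c_l = Σ_{0 ≤ x < N, x ≡ l (mod p)} w_𝒜(x). Then Σ_{s=1}^k λ_s ζ_p^{a_s}/(1 − ζ_p^{n_s}) = 0 if and only if Σ_{l=0}^{p−1} c_l ζ_p^l = 0. -/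
open Finset
open scoped Classical

/-- Geometric sum over the elements of `range (n * m)` in a residue class modulo `n`. -/
theorem sum_range_mul_ite_residue_pow {R : Type*} [CommSemiring R] {a n : ℕ} (m : ℕ)
    (han : a < n) (z : R) :
    ∑ x ∈ range (n * m), (if (n : ℤ) ∣ (x : ℤ) - (a : ℤ) then z ^ x else 0) =
      z ^ a * ∑ j ∈ range m, (z ^ n) ^ j := by
  rw [← Finset.sum_filter, Finset.mul_sum]
  symm
  refine Finset.sum_bij (fun j _ => a + n * j) ?_ ?_ ?_ ?_
  · intro j hj
    rw [mem_range] at hj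
    rw [mem_filter, mem_range]
    refine ⟨?_, ⟨(j : ℤ), by push_cast; ring⟩⟩
    calc a + n * j < n + n * j := by omega
      _ = n * (j + 1) := by ring
      _ ≤ n * m := Nat.mul_le_mul_left _ hj
  · intro i _ j _ h
    exact Nat.eq_of_mul_eq_mul_left (by omega : 0 < n) (Nat.add_left_cancel h)
  · intro x hx
    rw [mem_filter, mem_range] at hx
    obtain ⟨hx, hd⟩ := hx
    have hmod : x % n = a := by
      have h := (Nat.modEq_iff_dvd.mpr hd).symm
      rwa [Nat.ModEq, Nat.mod_eq_of_lt han] at h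
    refine ⟨x / n, mem_range.mpr (Nat.div_lt_of_lt_mul hx), ?_⟩
    rw [← hmod]
    exact Nat.mod_add_div x n
  · intro j _
    rw [pow_add, pow_mul]

/-- Equivalence (2.1) in the proof of Theorem 1.2: for
`𝒜 = {⟨λ_s, a_s, n_s⟩}_{s=1}^k` (with `n_s ≥ 1`, `0 ≤ a_s < n_s`), a prime `p`
greater than all moduli, a primitive `p`-th root of unity `ζ`, a positive
common multiple `N` of the moduli with `N ≡ 1 (mod p)`, and
`c_l = ∑_{0 ≤ x < N, x ≡ l (mod p)} w_𝒜(x)`, one has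
`∑_s λ_s ζ^{a_s}/(1 − ζ^{n_s}) = 0 ↔ ∑_{l=0}^{p−1} c_l ζ^l = 0`. -/
theorem sum_zeta_zero_iff_c_sum_zero
    {k : ℕ} (lam : Fin k → ℤ) (a n : Fin k → ℕ)
    (hn : ∀ s, 0 < n s) (ha : ∀ s, a s < n s)
    (p : ℕ) (hp : p.Prime) (hpn : ∀ s, n s < p)
    (ζ : ℂ) (hζ : IsPrimitiveRoot ζ p)
    (N : ℕ) (hN : 0 < N) (hdvd : ∀ s, n s ∣ N) (hNp : N % p = 1)
    (c : ℕ → ℤ)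
    (hc : ∀ l, c l = ∑ x ∈ (range N).filter (fun x => x % p = l),
        ∑ s ∈ (univ : Finset (Fin k)).filter
          (fun s => (n s : ℤ) ∣ (x : ℤ) - (a s : ℤ)), lam s) :
    ∑ s, (lam s : ℂ) * ζ ^ (a s) / (1 - ζ ^ (n s)) = 0 ↔
      ∑ l ∈ range p, (c l : ℂ) * ζ ^ l = 0 := by
  have hζ1 : 1 - ζ ≠ 0 := sub_ne_zero.mpr (hζ.ne_one hp.one_lt).symm
  have hζN : ζ ^ N = ζ := by
    rw [← Nat.mod_add_div N p, hNp, pow_add, pow_mul, hζ.pow_eq_one, one_pow, mul_one, pow_one]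
  have key : ∑ l ∈ range p, (c l : ℂ) * ζ ^ l =
      (1 - ζ) * ∑ s, (lam s : ℂ) * ζ ^ (a s) / (1 - ζ ^ (n s)) := by
    calc ∑ l ∈ range p, (c l : ℂ) * ζ ^ l
        = ∑ l ∈ range p, ∑ x ∈ range N with x % p = l,
            ∑ s, (lam s : ℂ) * (if (n s : ℤ) ∣ (x : ℤ) - (a s : ℤ) then ζ ^ x else 0) := by
          refine Finset.sum_congr rfl fun l _ => ?_
          rw [hc, Int.cast_sum, Finset.sum_mul]
          refine Finset.sum_congr rfl fun x hx => ?_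
          have hx' : ζ ^ x = ζ ^ l := by
            rw [← (mem_filter.mp hx).2, hζ.eq_orderOf, pow_mod_orderOf]
          rw [Int.cast_sum, Finset.sum_mul, Finset.sum_filter, hx']
          simp only [mul_ite, mul_zero]
      _ = ∑ x ∈ range N, ∑ s, (lam s : ℂ) *
            (if (n s : ℤ) ∣ (x : ℤ) - (a s : ℤ) then ζ ^ x else 0) :=
          Finset.sum_fiberwise_of_maps_to
            (fun x _ => mem_range.mpr (Nat.mod_lt x hp.pos)) _
      _ = (1 - ζ) * ∑ s, (lam s : ℂ) * ζ ^ (a s) / (1 - ζ ^ (n s)) := by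
          rw [Finset.sum_comm, Finset.mul_sum]
          refine Finset.sum_congr rfl fun s _ => ?_
          have hne : ζ ^ n s ≠ 1 := hζ.pow_ne_one_of_pos_of_lt (hn s).ne' (hpn s)
          have hne' : 1 - ζ ^ n s ≠ 0 := sub_ne_zero.mpr hne.symm
          obtain ⟨m, hm⟩ := hdvd s
          have hgeom : (∑ j ∈ range m, (ζ ^ n s) ^ j) * (1 - ζ ^ n s) = 1 - ζ := by
            rw [geom_sum_mul_neg, ← pow_mul, ← hm, hζN]
          rw [← Finset.mul_sum, hm, sum_range_mul_ite_residue_pow m (ha s), ← hgeom]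
          field_simp
  rw [key, mul_eq_zero, or_iff_right hζ1]
end
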